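/- arXiv:2509.15458 — 2 statements merged into one kernel-verified Lean document; each statement's English description precedes it below -/
import Mathlib

section
/- For every integer t ≥ 2 there is an integer c such that every n-vertex graph that is K_t-free, theta-free and pyramid-free is (t^c · log n)-pairwise separable, i.e., for every pair of non-adjacent vertices u, v there is a set X of at most t^c · log n vertices, disjoint from {u,v}, whose removal separates u from v. -/
open SimpleGraph

namespace Paper

variable {V : Type*}

/-- `S` is an independent (stable) set in `G`. -/
def IsIndep (G : SimpleGraph V) (S : Set V) : Prop :=
  ∀ ⦃a⦄, a ∈ S → ∀ ⦃b⦄, b ∈ S → a ≠ b → ¬ G.Adj a b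

/-- The independence number of `S` is at most `k`. -/
def IndepNumLE (G : SimpleGraph V) (S : Set V) (k : ℕ) : Prop :=
  ∀ T : Finset V, ↑T ⊆ S → IsIndep G ↑T → T.card ≤ k

/-- There are no edges between `A` and `B`. -/
def Anticomplete (G : SimpleGraph V) (A B : Set V) : Prop :=
  ∀ ⦃a⦄, a ∈ A → ∀ ⦃b⦄, b ∈ B → ¬ G.Adj a b

/-- `G` has no induced `K_{t,t}`. -/
def KttFree (G : SimpleGraph V) (t : ℕ) : Prop :=
  ¬ ∃ A B : Finset V, Disjoint A B ∧ A.card = t ∧ B.card = t ∧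
      IsIndep G ↑A ∧ IsIndep G ↑B ∧ ∀ a ∈ A, ∀ b ∈ B, G.Adj a b

/-- `P` is an induced path in `G`. -/
def IsInducedPathW (G : SimpleGraph V) {a b : V} (P : G.Walk a b) : Prop :=
  P.IsPath ∧ ∀ u ∈ P.support, ∀ v ∈ P.support, G.Adj u v → s(u, v) ∈ P.edges

/-- The interior of a path: its support minus the two ends. -/
def interiorSet (G : SimpleGraph V) {a b : V} (P : G.Walk a b) : Set V :=
  {v | v ∈ P.support ∧ v ≠ a ∧ v ≠ b}

/-- `G` contains a theta as an induced subgraph. -/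
def ContainsTheta (G : SimpleGraph V) : Prop :=
  ∃ (a b : V) (P₁ P₂ P₃ : G.Walk a b),
    a ≠ b ∧ ¬ G.Adj a b ∧
    IsInducedPathW G P₁ ∧ IsInducedPathW G P₂ ∧ IsInducedPathW G P₃ ∧
    2 ≤ P₁.length ∧ 2 ≤ P₂.length ∧ 2 ≤ P₃.length ∧
    Disjoint (interiorSet G P₁) (interiorSet G P₂) ∧
    Disjoint (interiorSet G P₁) (interiorSet G P₃) ∧
    Disjoint (interiorSet G P₂) (interiorSet G P₃) ∧
    Anticomplete G (interiorSet G P₁) (interiorSet G P₂) ∧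
    Anticomplete G (interiorSet G P₁) (interiorSet G P₃) ∧
    Anticomplete G (interiorSet G P₂) (interiorSet G P₃)

def ThetaFree (G : SimpleGraph V) : Prop := ¬ ContainsTheta G

/-- `G` contains a pyramid as an induced subgraph. -/
def ContainsPyramid (G : SimpleGraph V) : Prop :=
  ∃ (a : V) (b : Fin 3 → V) (P : ∀ i : Fin 3, G.Walk a (b i)),
    Function.Injective b ∧
    (∀ i j : Fin 3, i ≠ j → G.Adj (b i) (b j)) ∧
    (∀ i, IsInducedPathW G (P i)) ∧
    (∀ i, 1 ≤ (P i).length) ∧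
    (∀ i j : Fin 3, i ≠ j → (P i).length = 1 → (P j).length ≠ 1) ∧
    (∀ i j : Fin 3, i ≠ j → ∀ v, v ∈ (P i).support → v ∈ (P j).support → v = a) ∧
    (∀ i j : Fin 3, i ≠ j → ∀ u ∈ (P i).support, ∀ v ∈ (P j).support,
      u ≠ a → v ≠ a → G.Adj u v → u = b i ∧ v = b j)

def PyramidFree (G : SimpleGraph V) : Prop := ¬ ContainsPyramid G

/-- Open neighborhood of a set. -/
def nbhdS (G : SimpleGraph V) (X : Set V) : Set V := {v | v ∉ X ∧ ∃ x ∈ X, G.Adj x v}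

/-- Closed neighborhood of a set. -/
def nbhdC (G : SimpleGraph V) (X : Set V) : Set V := X ∪ nbhdS G X

/-- The boundary of `X` inside the induced subgraph `G[U]`. -/
def delta1 (G : SimpleGraph V) (U X : Set V) : Set V :=
  {v | v ∈ X ∧ ∃ u ∈ U \ X, G.Adj v u}

def delta2 (G : SimpleGraph V) (U X : Set V) : Set V := delta1 G U (X \ delta1 G U X)

/-- `S` induces a connected subgraph. -/
def ConnSet (G : SimpleGraph V) (S : Set V) : Prop := (G.induce S).Connected

/-- `X` is a cooperative set in the induced subgraph `G[U]`. -/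
def Cooperative (G : SimpleGraph V) (U X : Set V) : Prop :=
  X ⊆ U ∧ ConnSet G X ∧
  (∀ v ∈ delta1 G U X, ∃ u ∈ X \ delta1 G U X, G.Adj v u) ∧
  (∀ v ∈ delta2 G U X, ∃ u ∈ X \ (delta1 G U X ∪ delta2 G U X), G.Adj v u) ∧
  ConnSet G (X \ (delta1 G U X ∪ delta2 G U X))

/-- The finite set `A` is matched into `B` by a matching of `G`. -/
def MatchedInto (G : SimpleGraph V) (A : Finset V) (B : Set V) : Prop :=
  ∃ f : V → V, Set.InjOn f ↑A ∧ ∀ a ∈ A, f a ∈ B ∧ G.Adj a (f a)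

/-- There are `|A|` paths from `A` to `b`, pairwise vertex-disjoint except at `b`,
internally disjoint from `N[X]`. -/
def LinkedTo (G : SimpleGraph V) (X : Set V) (A : Finset V) (b : V) : Prop :=
  ∃ P : ∀ a ∈ A, G.Walk a b,
    (∀ a (ha : a ∈ A), (P a ha).IsPath) ∧
    (∀ a (ha : a ∈ A), ∀ v ∈ (P a ha).support, v ≠ a → v ≠ b → v ∉ nbhdC G X) ∧
    (∀ a (ha : a ∈ A), ∀ a' (ha' : a' ∈ A), a ≠ a' →
      ∀ v, v ∈ (P a ha).support → v ∈ (P a' ha').support → v = b)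

/-- `(S, I)` is a matroid. -/
def IsMatroid [DecidableEq V] (S : Set V) (I : Set (Finset V)) : Prop :=
  (∅ ∈ I) ∧ (∀ A ∈ I, ↑A ⊆ S) ∧
  (∀ A B : Finset V, A ⊆ B → B ∈ I → A ∈ I) ∧
  (∀ A B : Finset V, A ∈ I → B ∈ I → A.card < B.card → ∃ x ∈ B, x ∉ A ∧ insert x A ∈ I)

/-- `D` is a connected component of `G` minus the set `avoid`. -/
def IsCompAvoiding (G : SimpleGraph V) (avoid D : Set V) : Prop :=
  D ⊆ avoidᶜ ∧ ConnSet G D ∧ ∀ u, u ∉ D → u ∉ avoid → ¬ ∃ d ∈ D, G.Adj u d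

/-- `Z` is a constricted set. -/
def Constricted (G : SimpleGraph V) (Z : Set V) : Prop :=
  IsIndep G Z ∧ ∀ S : Set V, (G.induce S).IsTree → (Z ∩ S).ncard ≤ 2

end Paper

namespace Sep

open Paper

variable {V : Type} {G : SimpleGraph V}

/-- connectivity inside a set -/
def Cn (G : SimpleGraph V) (A : Set V) (a b : V) : Prop :=
  a ∈ A ∧ Relation.ReflTransGen (fun x y => G.Adj x y ∧ y ∈ A) a b

lemma Cn.refl {A : Set V} {a : V} (h : a ∈ A) : Cn G A a a := ⟨h, .refl⟩

lemma Cn.left {A : Set V} {a b : V} (h : Cn G A a b) : a ∈ A := h.1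

lemma Cn.right {A : Set V} {a b : V} (h : Cn G A a b) : b ∈ A := by
  obtain ⟨h1, h2⟩ := h
  cases h2 with
  | refl => exact h1
  | tail _ h => exact h.2

lemma Cn.step {A : Set V} {a b c : V} (h : Cn G A a b) (hbc : G.Adj b c) (hc : c ∈ A) :
    Cn G A a c := ⟨h.1, h.2.tail ⟨hbc, hc⟩⟩

lemma Cn.trans {A : Set V} {a b c : V} (h : Cn G A a b) (h' : Cn G A b c) : Cn G A a c :=
  ⟨h.1, h.2.trans h'.2⟩

lemma Cn.symm {A : Set V} {a b : V} (h : Cn G A a b) : Cn G A b a := by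
  obtain ⟨h1, h2⟩ := h
  induction h2 with
  | refl => exact Cn.refl h1
  | @tail b c hab hbc ih =>
    have hb : b ∈ A := ih.left
    exact ((Cn.refl hbc.2).step hbc.1.symm hb).trans ih

lemma Cn.mono {A B : Set V} {a b : V} (h : Cn G A a b) (hAB : A ⊆ B) : Cn G B a b :=
  ⟨hAB h.1, Relation.ReflTransGen.mono (fun _ _ h => ⟨h.1, hAB h.2⟩) _ _ h.2⟩

lemma Cn.closed {A S : Set V} {a b : V} (h : Cn G A a b) (ha : a ∈ S)
    (hS : ∀ w ∈ S, ∀ w' ∈ A, G.Adj w w' → w' ∈ S) : b ∈ S := by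
  obtain ⟨h1, h2⟩ := h
  induction h2 with
  | refl => exact ha
  | tail _ hbc ih => exact hS _ ih _ hbc.2 hbc.1

lemma Cn.exit {A K : Set V} {m n : V} (h : Cn G A m n) (hm : m ∈ K) (hn : n ∉ K) :
    ∃ d e, Cn G (A ∩ K) m d ∧ G.Adj d e ∧ e ∈ A ∧ e ∉ K := by
  obtain ⟨h1, h2⟩ := h
  by_contra hcon
  push Not at hcon
  have : Cn G (A ∩ K) m n := by
    clear hn
    induction h2 with
    | refl => exact Cn.refl ⟨h1, hm⟩
    | @tail b c hab hbc ih =>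
      exact ih.step hbc.1 ⟨hbc.2, hcon _ _ ih hbc.1 hbc.2⟩
  exact hn this.right.2

lemma Cn.of_walk {A : Set V} {a b : V} (p : G.Walk a b) (h : ∀ w ∈ p.support, w ∈ A) :
    Cn G A a b := by
  induction p with
  | nil => exact Cn.refl (h _ (by simp))
  | @cons u v w huv p ih =>
    have hv := ih (fun w hw => h w (by simp [hw]))
    exact ((Cn.refl (h u (by simp))).step huv hv.left).trans hv

/-- the component of `a` in `A` -/
def comp (G : SimpleGraph V) (A : Set V) (a : V) : Set V := {b | Cn G A a b}

lemma comp_sub {A : Set V} {a : V} : comp G A a ⊆ A := fun _ h => Cn.right h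

lemma mem_comp_self {A : Set V} {a : V} (h : a ∈ A) : a ∈ comp G A a := Cn.refl h

lemma comp_step {A : Set V} {a b c : V} (hb : b ∈ comp G A a) (h : G.Adj b c) (hc : c ∈ A) :
    c ∈ comp G A a := Cn.step hb h hc

/-- a connected set -/
def CS (G : SimpleGraph V) (K : Set V) : Prop := ∀ a ∈ K, ∀ b ∈ K, Cn G K a b

lemma comp_in {A : Set V} {a b : V} (hb : b ∈ comp G A a) : Cn G (comp G A a) a b := by
  have hb' : Cn G A a b := hb
  obtain ⟨h1, h2⟩ := hb'
  clear hb
  induction h2 with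
  | refl => exact Cn.refl (mem_comp_self h1)
  | @tail b c hab hbc ih => exact ih.step hbc.1 (comp_step ih.right hbc.1 hbc.2)

lemma comp_CS {A : Set V} {a : V} : CS G (comp G A a) := fun _ hb _ hc =>
  (comp_in hb).symm.trans (comp_in hc)

lemma CS_of_center {K : Set V} {a : V} (h : ∀ b ∈ K, Cn G K a b) : CS G K :=
  fun _ hb _ hc => (h _ hb).symm.trans (h _ hc)

/-- a connected set containing `a` and contained in `A` lies in the component -/
lemma CS.sub_comp {A K : Set V} {a : V} (hK : CS G K) (ha : a ∈ K) (hKA : K ⊆ A) :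
    K ⊆ comp G A a := fun b hb => (hK a ha b hb).mono hKA

lemma CS.cross {K L : Set V} (hK : CS G K) {a b : V} (ha : a ∈ K) (hb : b ∈ K)
    (haL : a ∈ L) (hbL : b ∉ L) : ∃ d e, d ∈ K ∧ d ∈ L ∧ e ∈ K ∧ e ∉ L ∧ G.Adj d e := by
  obtain ⟨d, e, h1, h2, h3, h4⟩ := (hK a ha b hb).exit haL hbL
  exact ⟨d, e, h1.right.1, h1.right.2, h3, h4, h2⟩

lemma CS.ins {K : Set V} (hK : CS G K) {a b : V} (hb : b ∈ K) (hab : G.Adj a b) :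
    CS G (insert a K) := by
  apply CS_of_center (a := b)
  intro c hc
  have hb' : b ∈ insert a K := Or.inr hb
  rcases hc with rfl | hc
  · exact (Cn.refl hb').step hab.symm (Or.inl rfl)
  · exact (hK b hb c hc).mono (Set.subset_insert _ _)

lemma CS.union {K L : Set V} (hK : CS G K) (hL : CS G L) {a b : V} (ha : a ∈ K) (hb : b ∈ L)
    (hab : G.Adj a b) : CS G (K ∪ L) := by
  apply CS_of_center (a := a)
  intro c hc
  rcases hc with hc | hc
  · exact (hK a ha c hc).mono Set.subset_union_left
  · exact ((Cn.refl (show a ∈ K ∪ L from Or.inl ha)).step hab (show b ∈ K ∪ L from Or.inr hb)).trans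
      ((hL b hb c hc).mono Set.subset_union_right)

/-- induced path given by a function -/
def IndP (G : SimpleGraph V) (f : ℕ → V) (l : ℕ) : Prop :=
  (∀ i ≤ l, ∀ j ≤ l, f i = f j → i = j) ∧
  (∀ i j, i < j → j ≤ l → (G.Adj (f i) (f j) ↔ j = i + 1))

lemma exists_indP {K : Set V} {b c : V} (h : Cn G K b c) :
    ∃ (l : ℕ) (f : ℕ → V), IndP G f l ∧ f 0 = b ∧ f l = c ∧ ∀ i ≤ l, f i ∈ K := by
  have hbK := h.left
  have hcK := h.right
  obtain ⟨-, h2⟩ := h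
  induction h2 using Relation.ReflTransGen.head_induction_on with
  | refl =>
    exact ⟨0, fun _ => c, ⟨fun i hi j hj _ => by omega, fun i j h1 h2 => by omega⟩, rfl, rfl,
      fun _ _ => hcK⟩
  | @head a d had hdc ih =>
    obtain ⟨l, f, hf, h0, hl, hK⟩ := ih had.2
    classical
    let P : ℕ → Prop := fun k => f k = a ∨ G.Adj a (f k)
    have hP0 : P 0 := Or.inr (by rw [h0]; exact had.1)
    set j := Nat.findGreatest P l with hj
    have hPj : P j := Nat.findGreatest_spec (Nat.zero_le l) hP0
    have hjl : j ≤ l := Nat.findGreatest_le l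
    have hmax : ∀ k, j < k → k ≤ l → ¬ P k := fun k h1 h2 =>
      Nat.findGreatest_is_greatest h1 h2
    by_cases hja : f j = a
    · refine ⟨l - j, fun k => f (j + k), ⟨?_, ?_⟩, by simpa using hja, ?_, ?_⟩
      · intro i hi k hk hik
        have := hf.1 (j + i) (by omega) (j + k) (by omega) hik
        omega
      · intro i k hik hk
        have := hf.2 (j + i) (j + k) (by omega) (by omega)
        rw [this]; omega
      · show f (j + (l - j)) = c
        rw [show j + (l - j) = l by omega, hl]
      · intro i hi; exact hK _ (by omega)
    · have hadj : G.Adj a (f j) := hPj.resolve_left hja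
      refine ⟨l - j + 1, fun k => if k = 0 then a else f (j + (k - 1)), ⟨?_, ?_⟩, by simp, ?_, ?_⟩
      · intro i hi k hk hik
        have hne : ∀ m, 1 ≤ m → m ≤ l - j + 1 → f (j + (m - 1)) ≠ a := by
          intro m hm1 hm2 heq
          rcases Nat.eq_or_lt_of_le hm1 with h | h
          · subst h; exact hja (by simpa using heq)
          · exact hmax (j + (m-1)) (by omega) (by omega) (Or.inl heq)
        by_cases hi0 : i = 0 <;> by_cases hk0 : k = 0
        · omega
        · simp only [hi0, hk0, if_true, if_false] at hik
          exact absurd hik.symm (hne k (by omega) hk)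
        · simp only [hi0, hk0, if_true, if_false] at hik
          exact absurd hik (hne i (by omega) hi)
        · simp only [hi0, hk0, if_false] at hik
          have := hf.1 _ (by omega) _ (by omega) hik
          omega
      · intro i k hik hk
        have hk0 : k ≠ 0 := by omega
        by_cases hi0 : i = 0
        · simp only [hi0, hk0, if_true, if_false]
          constructor
          · intro h
            by_contra hne
            exact hmax (j + (k-1)) (by omega) (by omega) (Or.inr h)
          · intro h; subst h; simpa using hadj
        · simp only [hi0, hk0, if_false]
          rw [hf.2 _ _ (by omega) (by omega)]; omega
      · simp only [Nat.add_eq_zero_iff, one_ne_zero, and_false, if_false]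
        rw [show j + (l - j + 1 - 1) = l by omega, hl]
      · intro i hi
        by_cases hi0 : i = 0
        · simp [hi0, hbK]
        · simp only [hi0, if_false]; exact hK _ (by omega)

/-- walk along an induced path function -/
lemma walk_of_indP {f : ℕ → V} {l : ℕ} (hf : IndP G f l) (i j : ℕ) (hij : i ≤ j) (hj : j ≤ l) :
    ∃ P : G.Walk (f i) (f j), IsInducedPathW G P ∧ P.length = j - i ∧
      ∀ w, w ∈ P.support ↔ ∃ k, i ≤ k ∧ k ≤ j ∧ w = f k := by
  have key : ∀ n i, i + n ≤ l → ∃ P : G.Walk (f i) (f (i + n)), P.IsPath ∧ P.length = n ∧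
      (∀ w, w ∈ P.support ↔ ∃ k, i ≤ k ∧ k ≤ i + n ∧ w = f k) ∧
      ∀ k, i ≤ k → k < i + n → s(f k, f (k+1)) ∈ P.edges := by
    intro n
    induction n with
    | zero =>
      intro i hi
      refine ⟨Walk.nil, by simp, rfl, ?_, fun k h1 h2 => by omega⟩
      intro w
      simp only [Walk.support_nil, List.mem_singleton]
      constructor
      · intro h; exact ⟨i, le_rfl, by omega, h⟩
      · rintro ⟨k, h1, h2, h3⟩
        have : k = i := by omega
        rw [h3, this]
    | succ n ih =>
      intro i hi
      obtain ⟨P, hp, hlen, hs, he⟩ := ih (i+1) (by omega)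
      have hadj : G.Adj (f i) (f (i+1)) := (hf.2 i (i+1) (by omega) (by omega)).2 rfl
      have e : i + 1 + n = i + (n + 1) := by omega
      refine ⟨(Walk.cons hadj P).copy rfl (by rw [e]), ?_, ?_, ?_, ?_⟩
      · rw [Walk.isPath_copy, Walk.cons_isPath_iff]
        refine ⟨hp, ?_⟩
        rw [hs]
        rintro ⟨k, h1, h2, h3⟩
        have := hf.1 i (by omega) k (by omega) h3
        omega
      · simp [hlen]
      · intro w
        simp only [Walk.support_copy, Walk.support_cons, List.mem_cons, hs]
        constructor
        · rintro (h | ⟨k, h1, h2, h3⟩)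
          · exact ⟨i, le_rfl, by omega, h⟩
          · exact ⟨k, by omega, by omega, h3⟩
        · rintro ⟨k, h1, h2, h3⟩
          by_cases hk : k = i
          · left; rw [h3, hk]
          · right; exact ⟨k, by omega, by omega, h3⟩
      · intro k h1 h2
        simp only [Walk.edges_copy, Walk.edges_cons, List.mem_cons]
        by_cases hk : k = i
        · left; rw [hk]
        · right; exact he k (by omega) (by omega)
  obtain ⟨P, hp, hlen, hs, he⟩ := key (j - i) i (by omega)
  have e : i + (j - i) = j := by omega
  refine ⟨P.copy rfl (by rw [e]), ⟨by rw [Walk.isPath_copy]; exact hp, ?_⟩, by simp [hlen], ?_⟩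
  · intro u hu v hv huv
    rw [Walk.support_copy, hs] at hu hv
    rw [Walk.edges_copy]
    obtain ⟨k, h1, h2, rfl⟩ := hu
    obtain ⟨m, h3, h4, rfl⟩ := hv
    rcases lt_trichotomy k m with h | h | h
    · have := (hf.2 k m h (by omega)).1 huv
      subst this
      exact he k h1 (by omega)
    · subst h; exact absurd huv (G.loopless.irrefl _)
    · have := (hf.2 m k h (by omega)).1 huv.symm
      subst this
      rw [Sym2.eq_swap]
      exact he m h3 (by omega)
  · intro w
    rw [Walk.support_copy, hs, e]

lemma ind_cons {a b c : V} {P : G.Walk b c} (hP : IsInducedPathW G P) (hab : G.Adj a b)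
    (ha : a ∉ P.support) (h : ∀ w ∈ P.support, G.Adj a w → w = b) :
    IsInducedPathW G (Walk.cons hab P) := by
  refine ⟨(Walk.cons_isPath_iff hab P).2 ⟨hP.1, ha⟩, ?_⟩
  intro u hu v hv huv
  simp only [Walk.support_cons, List.mem_cons] at hu hv
  simp only [Walk.edges_cons, List.mem_cons]
  rcases hu with rfl | hu <;> rcases hv with rfl | hv
  · exact absurd huv (G.loopless.irrefl _)
  · left; rw [h v hv huv]
  · left; rw [h u hu huv.symm, Sym2.eq_swap]
  · right; exact hP.2 u hu v hv huv

lemma ind_rev {b c : V} {P : G.Walk b c} (hP : IsInducedPathW G P) :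
    IsInducedPathW G P.reverse := by
  refine ⟨hP.1.reverse, ?_⟩
  intro u hu v hv huv
  rw [Walk.support_reverse, List.mem_reverse] at hu hv
  rw [Walk.edges_reverse, List.mem_reverse]
  exact hP.2 u hu v hv huv

lemma theta_of {a b : V} (P₁ P₂ P₃ : G.Walk a b) (S₁ S₂ S₃ : Set V)
    (hab : a ≠ b) (nab : ¬ G.Adj a b)
    (h1 : IsInducedPathW G P₁) (h2 : IsInducedPathW G P₂) (h3 : IsInducedPathW G P₃)
    (l1 : 2 ≤ P₁.length) (l2 : 2 ≤ P₂.length) (l3 : 2 ≤ P₃.length)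
    (s1 : ∀ w ∈ P₁.support, w = a ∨ w = b ∨ w ∈ S₁)
    (s2 : ∀ w ∈ P₂.support, w = a ∨ w = b ∨ w ∈ S₂)
    (s3 : ∀ w ∈ P₃.support, w = a ∨ w = b ∨ w ∈ S₃)
    (d12 : ∀ w ∈ S₁, ∀ w' ∈ S₂, w ≠ w' ∧ ¬ G.Adj w w')
    (d13 : ∀ w ∈ S₁, ∀ w' ∈ S₃, w ≠ w' ∧ ¬ G.Adj w w')
    (d23 : ∀ w ∈ S₂, ∀ w' ∈ S₃, w ≠ w' ∧ ¬ G.Adj w w') : ContainsTheta G := by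
  have e1 : ∀ w ∈ interiorSet G P₁, w ∈ S₁ := fun w hw => by
    rcases s1 w hw.1 with h | h | h
    · exact absurd h hw.2.1
    · exact absurd h hw.2.2
    · exact h
  have e2 : ∀ w ∈ interiorSet G P₂, w ∈ S₂ := fun w hw => by
    rcases s2 w hw.1 with h | h | h
    · exact absurd h hw.2.1
    · exact absurd h hw.2.2
    · exact h
  have e3 : ∀ w ∈ interiorSet G P₃, w ∈ S₃ := fun w hw => by
    rcases s3 w hw.1 with h | h | h
    · exact absurd h hw.2.1
    · exact absurd h hw.2.2
    · exact h
  refine ⟨a, b, P₁, P₂, P₃, hab, nab, h1, h2, h3, l1, l2, l3, ?_, ?_, ?_, ?_, ?_, ?_⟩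
  · exact Set.disjoint_left.2 fun w hw hw' => (d12 w (e1 w hw) w (e2 w hw')).1 rfl
  · exact Set.disjoint_left.2 fun w hw hw' => (d13 w (e1 w hw) w (e3 w hw')).1 rfl
  · exact Set.disjoint_left.2 fun w hw hw' => (d23 w (e2 w hw) w (e3 w hw')).1 rfl
  · exact fun w hw w' hw' => (d12 w (e1 w hw) w' (e2 w' hw')).2
  · exact fun w hw w' hw' => (d13 w (e1 w hw) w' (e3 w' hw')).2
  · exact fun w hw w' hw' => (d23 w (e2 w hw) w' (e3 w' hw')).2

lemma pyr_of {a b₁ b₂ b₃ : V} (P₁ : G.Walk a b₁) (P₂ : G.Walk a b₂) (P₃ : G.Walk a b₃)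
    (S₁ S₂ S₃ : Set V)
    (a12 : G.Adj b₁ b₂) (a13 : G.Adj b₁ b₃) (a23 : G.Adj b₂ b₃)
    (h1 : IsInducedPathW G P₁) (h2 : IsInducedPathW G P₂) (h3 : IsInducedPathW G P₃)
    (l1 : 2 ≤ P₁.length) (l2 : 2 ≤ P₂.length) (l3 : 2 ≤ P₃.length)
    (s1 : ∀ w ∈ P₁.support, w = a ∨ w ∈ S₁)
    (s2 : ∀ w ∈ P₂.support, w = a ∨ w ∈ S₂)
    (s3 : ∀ w ∈ P₃.support, w = a ∨ w ∈ S₃)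
    (d12 : ∀ w ∈ S₁, ∀ w' ∈ S₂, w ≠ w' ∧ (G.Adj w w' → w = b₁ ∧ w' = b₂))
    (d13 : ∀ w ∈ S₁, ∀ w' ∈ S₃, w ≠ w' ∧ (G.Adj w w' → w = b₁ ∧ w' = b₃))
    (d23 : ∀ w ∈ S₂, ∀ w' ∈ S₃, w ≠ w' ∧ (G.Adj w w' → w = b₂ ∧ w' = b₃)) :
    ContainsPyramid G := by
  have t12 : ∀ v, v ∈ P₁.support → v ∈ P₂.support → v = a := fun v hv hv' => by
    rcases s1 v hv with h | h
    · exact h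
    · rcases s2 v hv' with h' | h'
      · exact h'
      · exact absurd rfl (d12 v h v h').1
  have t13 : ∀ v, v ∈ P₁.support → v ∈ P₃.support → v = a := fun v hv hv' => by
    rcases s1 v hv with h | h
    · exact h
    · rcases s3 v hv' with h' | h'
      · exact h'
      · exact absurd rfl (d13 v h v h').1
  have t23 : ∀ v, v ∈ P₂.support → v ∈ P₃.support → v = a := fun v hv hv' => by
    rcases s2 v hv with h | h
    · exact h
    · rcases s3 v hv' with h' | h'
      · exact h'
      · exact absurd rfl (d23 v h v h').1
  have u12 : ∀ u ∈ P₁.support, ∀ v ∈ P₂.support, u ≠ a → v ≠ a → G.Adj u v → u = b₁ ∧ v = b₂ :=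
    fun u hu v hv hua hva => (d12 u ((s1 u hu).resolve_left hua) v ((s2 v hv).resolve_left hva)).2
  have u13 : ∀ u ∈ P₁.support, ∀ v ∈ P₃.support, u ≠ a → v ≠ a → G.Adj u v → u = b₁ ∧ v = b₃ :=
    fun u hu v hv hua hva => (d13 u ((s1 u hu).resolve_left hua) v ((s3 v hv).resolve_left hva)).2
  have u23 : ∀ u ∈ P₂.support, ∀ v ∈ P₃.support, u ≠ a → v ≠ a → G.Adj u v → u = b₂ ∧ v = b₃ :=
    fun u hu v hv hua hva => (d23 u ((s2 u hu).resolve_left hua) v ((s3 v hv).resolve_left hva)).2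
  let b : Fin 3 → V := ![b₁, b₂, b₃]
  let P : ∀ i : Fin 3, G.Walk a (b i) := fun i => match i with
    | 0 => P₁
    | 1 => P₂
    | 2 => P₃
  refine ⟨a, b, P, ?_, ?_, ?_, ?_, ?_, ?_, ?_⟩
  · intro i j hij
    fin_cases i <;> fin_cases j <;> first | rfl | skip
    · exact absurd hij a12.ne
    · exact absurd hij a13.ne
    · exact absurd hij.symm a12.ne
    · exact absurd hij a23.ne
    · exact absurd hij.symm a13.ne
    · exact absurd hij.symm a23.ne
  · intro i j hij
    fin_cases i <;> fin_cases j <;> first | exact absurd rfl hij | skip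
    · exact a12
    · exact a13
    · exact a12.symm
    · exact a23
    · exact a13.symm
    · exact a23.symm
  · intro i; fin_cases i
    · exact h1
    · exact h2
    · exact h3
  · intro i; fin_cases i
    · exact le_trans (by norm_num) l1
    · exact le_trans (by norm_num) l2
    · exact le_trans (by norm_num) l3
  · intro i j _ hi; exfalso; fin_cases i
    · have : P₁.length = 1 := hi
      omega
    · have : P₂.length = 1 := hi
      omega
    · have : P₃.length = 1 := hi
      omega
  · intro i j hij v hv hv'
    fin_cases i <;> fin_cases j <;> first | exact absurd rfl hij | skip
    · exact t12 v hv hv'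
    · exact t13 v hv hv'
    · exact t12 v hv' hv
    · exact t23 v hv hv'
    · exact t13 v hv' hv
    · exact t23 v hv' hv
  · intro i j hij u hu v hv hua hva huv
    fin_cases i <;> fin_cases j <;> first | exact absurd rfl hij | skip
    · exact u12 u hu v hv hua hva huv
    · exact u13 u hu v hv hua hva huv
    · exact (u12 v hv u hu hva hua huv.symm).symm
    · exact u23 u hu v hv hua hva huv
    · exact (u13 v hv u hu hva hua huv.symm).symm
    · exact (u23 v hv u hu hva hua huv.symm).symm


lemma ramsey0 (n : ℕ) : ∀ s t : ℕ, s + t ≤ n → ∃ N : ℕ, ∀ (V : Type) (G : SimpleGraph V) (A : Finset V),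
    N ≤ A.card → (∃ I ⊆ A, I.card = s ∧ ∀ a ∈ I, ∀ b ∈ I, ¬ G.Adj a b) ∨
      (∃ Q ⊆ A, Q.card = t ∧ ∀ a ∈ Q, ∀ b ∈ Q, a ≠ b → G.Adj a b) := by
  induction n with
  | zero =>
    intro s t h
    exact ⟨0, fun V G A _ => Or.inl ⟨∅, by simp, by simp; omega, by simp⟩⟩
  | succ n ih =>
    intro s t h
    rcases Nat.eq_zero_or_pos s with hs | hs
    · exact ⟨0, fun V G A _ => Or.inl ⟨∅, by simp, by simp; omega, by simp⟩⟩
    rcases Nat.eq_zero_or_pos t with ht | ht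
    · exact ⟨0, fun V G A _ => Or.inr ⟨∅, by simp, by simp; omega, by simp⟩⟩
    obtain ⟨N1, h1⟩ := ih (s-1) t (by omega)
    obtain ⟨N2, h2⟩ := ih s (t-1) (by omega)
    refine ⟨N1 + N2 + 1, fun V G A hA => ?_⟩
    classical
    obtain ⟨v, hv⟩ : A.Nonempty := by
      rw [← Finset.card_pos]; omega
    have hc := Finset.card_filter_add_card_filter_not (s := A.erase v) (fun w => G.Adj v w)
    rw [Finset.card_erase_of_mem hv] at hc
    by_cases hN : N1 ≤ ((A.erase v).filter (fun w => ¬ G.Adj v w)).card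
    · rcases h1 V G _ hN with ⟨I, hI, hIc, hIs⟩ | ⟨Q, hQ, h⟩
      · left
        have hI' : ∀ a ∈ I, a ∈ A ∧ a ≠ v ∧ ¬ G.Adj v a := fun a ha => by
          have := hI ha
          simp only [Finset.mem_filter, Finset.mem_erase] at this
          tauto
        refine ⟨insert v I, ?_, ?_, ?_⟩
        · intro a ha
          rcases Finset.mem_insert.1 ha with rfl | ha
          · exact hv
          · exact (hI' a ha).1
        · rw [Finset.card_insert_of_notMem (fun hvI => (hI' v hvI).2.1 rfl)]; omega
        · intro a ha b hb
          rcases Finset.mem_insert.1 ha with hav | ha' <;> rcases Finset.mem_insert.1 hb with hbv | hb'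
          · rw [hav, hbv]; exact G.loopless.irrefl _
          · rw [hav]; exact (hI' b hb').2.2
          · rw [hbv]; exact fun h => (hI' a ha').2.2 h.symm
          · exact hIs a ha' b hb'
      · right
        refine ⟨Q, fun a ha => ?_, h⟩
        have := hQ ha
        simp only [Finset.mem_filter, Finset.mem_erase] at this
        tauto
    · rcases h2 V G ((A.erase v).filter (fun w => G.Adj v w)) (by omega) with ⟨Q, hQ, h⟩ | ⟨I, hI, hIc, hIs⟩
      · left
        refine ⟨Q, fun a ha => ?_, h⟩
        have := hQ ha
        simp only [Finset.mem_filter, Finset.mem_erase] at this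
        tauto
      · right
        have hI' : ∀ a ∈ I, a ∈ A ∧ a ≠ v ∧ G.Adj v a := fun a ha => by
          have := hI ha
          simp only [Finset.mem_filter, Finset.mem_erase] at this
          tauto
        refine ⟨insert v I, ?_, ?_, ?_⟩
        · intro a ha
          rcases Finset.mem_insert.1 ha with rfl | ha
          · exact hv
          · exact (hI' a ha).1
        · rw [Finset.card_insert_of_notMem (fun hvI => (hI' v hvI).2.1 rfl)]; omega
        · intro a ha b hb hab
          rcases Finset.mem_insert.1 ha with hav | ha' <;> rcases Finset.mem_insert.1 hb with hbv | hb'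
          · exact absurd (hav.trans hbv.symm) hab
          · rw [hav]; exact (hI' b hb').2.2
          · rw [hbv]; exact ((hI' a ha').2.2).symm
          · exact hIs a ha' b hb' hab

lemma ramsey (s t : ℕ) : ∃ N : ℕ, ∀ (V : Type) [Finite V] (G : SimpleGraph V), G.CliqueFree t →
    ∀ A : Set V, N ≤ A.ncard → ∃ I ⊆ A, I.ncard = s ∧ ∀ a ∈ I, ∀ b ∈ I, ¬ G.Adj a b := by
  obtain ⟨N, hN⟩ := ramsey0 (s + t) s t le_rfl
  refine ⟨N, fun V _ G hG A hA => ?_⟩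
  have hfin := Set.toFinite A
  rcases hN V G hfin.toFinset (by rw [← Set.ncard_eq_toFinset_card A hfin]; exact hA) with
    ⟨I, hI, hIc, hIs⟩ | ⟨Q, hQ, hQc, hQs⟩
  · refine ⟨↑I, fun a ha => ?_, by rw [Set.ncard_coe_finset, hIc], fun a ha b hb => hIs a ha b hb⟩
    simpa using hI ha
  · exact absurd ⟨fun a ha b hb hab => hQs a ha b hb hab, hQc⟩ (hG Q)

/-- global hypotheses -/
structure Hyp (G : SimpleGraph V) (r0 c1 : ℕ) : Prop where
  th : ThetaFree G
  py : PyramidFree G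
  r2 : 2 ≤ r0
  st3 : ∀ A : Set V, r0 ≤ A.ncard → ∃ I ⊆ A, I.ncard = 3 ∧ ∀ a ∈ I, ∀ b ∈ I, ¬ G.Adj a b
  st : ∀ A : Set V, c1 ≤ A.ncard → ∃ I ⊆ A, I.ncard = r0 ∧ ∀ a ∈ I, ∀ b ∈ I, ¬ G.Adj a b

lemma path2 {x w y : V} (hxw : G.Adj x w) (hwy : G.Adj w y) (hxy : x ≠ y) (nxy : ¬ G.Adj x y) :
    ∃ P : G.Walk x y, IsInducedPathW G P ∧ P.length = 2 ∧ ∀ z ∈ P.support, z = x ∨ z = y ∨ z = w := by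
  have h0 : IsInducedPathW G (Walk.nil : G.Walk y y) := by
    refine ⟨by simp, ?_⟩
    intro u hu v hv huv
    simp at hu hv
    subst hu; subst hv
    exact absurd huv (G.loopless.irrefl _)
  refine ⟨Walk.cons hxw (Walk.cons hwy Walk.nil), ind_cons (ind_cons h0 hwy ?_ ?_) hxw ?_ ?_, rfl, ?_⟩
  · simpa using hwy.ne
  · intro z hz _; simpa using hz
  · simp [hxw.ne, hxy]
  · intro z hz hxz
    simp at hz
    rcases hz with rfl | rfl
    · rfl
    · exact absurd hxz nxy
  · intro z hz
    simp at hz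
    tauto

lemma k23 {x y a b c : V} (hxy : x ≠ y) (nxy : ¬ G.Adj x y) (xa : G.Adj x a) (xb : G.Adj x b)
    (xc : G.Adj x c) (ya : G.Adj y a) (yb : G.Adj y b) (yc : G.Adj y c)
    (ab : a ≠ b) (ac : a ≠ c) (bc : b ≠ c)
    (nab : ¬ G.Adj a b) (nac : ¬ G.Adj a c) (nbc : ¬ G.Adj b c) : ContainsTheta G := by
  obtain ⟨P1, h1, l1, s1⟩ := path2 xa ya.symm hxy nxy
  obtain ⟨P2, h2, l2, s2⟩ := path2 xb yb.symm hxy nxy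
  obtain ⟨P3, h3, l3, s3⟩ := path2 xc yc.symm hxy nxy
  refine theta_of P1 P2 P3 {a} {b} {c} hxy nxy h1 h2 h3 (by omega) (by omega) (by omega) s1 s2 s3 ?_ ?_ ?_
  · rintro w rfl w' rfl; exact ⟨ab, nab⟩
  · rintro w rfl w' rfl; exact ⟨ac, nac⟩
  · rintro w rfl w' rfl; exact ⟨bc, nbc⟩

lemma Hyp.cnb [Finite V] {r0 c1 : ℕ} (H : Hyp G r0 c1) {x y : V} (hxy : x ≠ y) (nxy : ¬ G.Adj x y) :
    {w | G.Adj x w ∧ G.Adj y w}.ncard < r0 := by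
  by_contra hcon
  obtain ⟨I, hI, hIc, hIs⟩ := H.st3 _ (not_lt.1 hcon)
  obtain ⟨a, b, c, ab, ac, bc, rfl⟩ := Set.ncard_eq_three.1 hIc
  have ha := hI (show a ∈ _ by simp)
  have hb := hI (show b ∈ _ by simp)
  have hc := hI (show c ∈ _ by simp)
  exact H.th (k23 hxy nxy ha.1 hb.1 hc.1 ha.2 hb.2 hc.2 ab ac bc (hIs _ (by simp) _ (by simp))
    (hIs _ (by simp) _ (by simp)) (hIs _ (by simp) _ (by simp)))

lemma ind_snoc {a b c : V} {P : G.Walk a b} (hP : IsInducedPathW G P) (hbc : G.Adj b c)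
    (hc : c ∉ P.support) (h : ∀ w ∈ P.support, G.Adj c w → w = b) :
    ∃ P' : G.Walk a c, IsInducedPathW G P' ∧ P'.length = P.length + 1 ∧
      ∀ w, w ∈ P'.support ↔ w = c ∨ w ∈ P.support := by
  refine ⟨(Walk.cons hbc.symm P.reverse).reverse, ind_rev (ind_cons (ind_rev hP) hbc.symm ?_ ?_), ?_, ?_⟩
  · simpa using hc
  · simpa using h
  · simp
  · intro w
    rw [Walk.support_reverse, List.mem_reverse, Walk.support_cons, List.mem_cons,
      Walk.support_reverse, List.mem_reverse]

lemma lemmaB {x n n' q q2 : V} {K1 K2 : Set V} (hK1 : CS G K1) (hK2 : CS G K2)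
    (hq1 : q2 ∈ K1) (hq2 : q2 ∈ K2) (xK1 : x ∉ K1) (xK2 : x ∉ K2)
    (nxK1 : ∀ w ∈ K1, ¬ G.Adj x w) (nxK2 : ∀ w ∈ K2, ¬ G.Adj x w)
    (xn : G.Adj x n) (xn' : G.Adj x n') (xq : G.Adj x q)
    (nnn' : ¬ G.Adj n n') (nnq : ¬ G.Adj n q) (nn'q : ¬ G.Adj n' q)
    (hn : ∃ w ∈ K1, G.Adj n w) (hn1 : ∀ w ∈ K1, ¬ G.Adj n' w)
    (hn' : ∃ w ∈ K2, G.Adj n' w) (hn2 : ∀ w ∈ K2, ¬ G.Adj n w)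
    (qq2 : G.Adj q q2) (qK1 : ∀ w ∈ K1, G.Adj q w → w = q2) (qK2 : ∀ w ∈ K2, G.Adj q w → w = q2) :
    ContainsTheta G ∨ ContainsPyramid G := by
  classical
  obtain ⟨k1, hk1, nk1⟩ := hn
  obtain ⟨k2, hk2, nk2⟩ := hn'
  have nK1 : n ∉ K1 := fun h => nxK1 n h xn
  have nK2 : n ∉ K2 := fun h => nxK2 n h xn
  have n'K1 : n' ∉ K1 := fun h => nxK1 n' h xn'
  have n'K2 : n' ∉ K2 := fun h => nxK2 n' h xn'
  have qnK1 : q ∉ K1 := fun h => nxK1 q h xq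
  have qnK2 : q ∉ K2 := fun h => nxK2 q h xq
  obtain ⟨a, p, hp, p0, pa, pK⟩ := exists_indP (hK1.ins hk1 nk1 n (Or.inl rfl) q2 (Or.inr hq1))
  obtain ⟨b, r, hr, r0, rb, rK⟩ := exists_indP (hK2.ins hk2 nk2 n' (Or.inl rfl) q2 (Or.inr hq2))
  have ha : 1 ≤ a := by
    by_contra h
    have : a = 0 := by omega
    subst this
    exact nK1 (by rw [← p0, pa]; exact hq1)
  have hb : 1 ≤ b := by
    by_contra h
    have : b = 0 := by omega
    subst this
    exact n'K1 (by rw [← r0, rb]; exact hq1)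
  have pK1 : ∀ i, 1 ≤ i → i ≤ a → p i ∈ K1 := by
    intro i h1 h2
    rcases pK i h2 with h | h
    · have := hp.1 i h2 0 (by omega) (by rw [h, p0]); omega
    · exact h
  have rK2 : ∀ i, 1 ≤ i → i ≤ b → r i ∈ K2 := by
    intro i h1 h2
    rcases rK i h2 with h | h
    · have := hr.1 i h2 0 (by omega) (by rw [h, r0]); omega
    · exact h
  have hex : ∃ j, ∃ i, 1 ≤ i ∧ i ≤ a ∧ G.Adj (r j) (p i) := by
    refine ⟨b - 1, a, ha, le_rfl, ?_⟩
    rw [pa, ← rb]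
    exact (hr.2 (b-1) b (by omega) le_rfl).2 (by omega)
  obtain ⟨j, hj, hjmin, hjb⟩ : ∃ j, (∃ i, 1 ≤ i ∧ i ≤ a ∧ G.Adj (r j) (p i)) ∧
      (∀ j' < j, ¬ ∃ i, 1 ≤ i ∧ i ≤ a ∧ G.Adj (r j') (p i)) ∧ j < b := by
    refine ⟨Nat.find hex, Nat.find_spec hex, fun j' h => Nat.find_min hex h, ?_⟩
    have : Nat.find hex ≤ b - 1 := by
      apply Nat.find_min'
      refine ⟨a, ha, le_rfl, ?_⟩
      rw [pa, ← rb]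
      exact (hr.2 (b-1) b (by omega) le_rfl).2 (by omega)
    omega
  have hj1 : 1 ≤ j := by
    by_contra h
    have : j = 0 := by omega
    subst this
    obtain ⟨i, h1, h2, h3⟩ := hj
    rw [r0] at h3
    exact hn1 _ (pK1 i h1 h2) h3
  -- facts
  have F0 : ∀ i' ≤ b, ¬ G.Adj (r i') (p 0) := by
    intro i' h1 h
    rw [p0] at h
    rcases Nat.eq_zero_or_pos i' with h0 | h0
    · subst h0; rw [r0] at h; exact nnn' h.symm
    · exact hn2 _ (rK2 i' h0 h1) h.symm
  have F1 : ∀ i' < j, ∀ i ≤ a, ¬ G.Adj (r i') (p i) := by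
    intro i' h1 i h2 h
    rcases Nat.eq_zero_or_pos i with h0 | h0
    · subst h0; exact F0 i' (by omega) h
    · exact hjmin i' h1 ⟨i, h0, h2, h⟩
  have F2 : ∀ i' ≤ j, ∀ i ≤ a, r i' ≠ p i := by
    intro i' h1 i h2 h
    rcases Nat.eq_zero_or_pos i with h0 | h0 <;> rcases Nat.eq_zero_or_pos i' with h0' | h0'
    · subst h0; subst h0'; rw [r0, p0] at h
      exact hn1 _ hk1 (h ▸ nk1)
    · subst h0; rw [p0] at h
      exact nK2 (h ▸ rK2 i' h0' (by omega))
    · subst h0'; rw [r0] at h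
      exact n'K1 (h ▸ pK1 i h0 h2)
    · apply F1 (i'-1) (by omega) i h2
      rw [← h]
      exact (hr.2 (i'-1) i' (by omega) (by omega)).2 (by omega)
  have Q1 : ∀ i ≤ a, G.Adj q (p i) → i = a := by
    intro i h1 h
    rcases Nat.eq_zero_or_pos i with h0 | h0
    · subst h0; rw [p0] at h; exact absurd h.symm nnq
    · exact hp.1 i h1 a le_rfl (by rw [pa]; exact qK1 _ (pK1 i h0 h1) h)
  have Q2 : ∀ i ≤ j, ¬ G.Adj q (r i) := by
    intro i h1 h
    rcases Nat.eq_zero_or_pos i with h0 | h0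
    · subst h0; rw [r0] at h; exact nn'q h.symm
    · have := hr.1 i (by omega) b le_rfl (by rw [rb]; exact qK2 _ (rK2 i h0 (by omega)) h)
      omega
  have Q3 : ∀ i ≤ a, q ≠ p i := by
    intro i h1 h
    rcases Nat.eq_zero_or_pos i with h0 | h0
    · subst h0; rw [p0] at h; exact hn2 _ hq2 (h ▸ qq2)
    · exact qnK1 (h ▸ pK1 i h0 h1)
  have Q4 : ∀ i ≤ j, q ≠ r i := by
    intro i h1 h
    rcases Nat.eq_zero_or_pos i with h0 | h0
    · subst h0; rw [r0] at h; exact hn1 _ hq1 (h ▸ qq2)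
    · exact qnK2 (h ▸ rK2 i h0 (by omega))
  have X1 : ∀ i ≤ a, G.Adj x (p i) → i = 0 := by
    intro i h1 h
    by_contra h0
    exact nxK1 _ (pK1 i (by omega) h1) h
  have X2 : ∀ i ≤ b, G.Adj x (r i) → i = 0 := by
    intro i h1 h
    by_contra h0
    exact nxK2 _ (rK2 i (by omega) h1) h
  have X3 : ∀ i ≤ a, x ≠ p i := by
    intro i h1 h
    rcases Nat.eq_zero_or_pos i with h0 | h0
    · subst h0; rw [p0] at h; exact xn.ne h
    · exact xK1 (h ▸ pK1 i h0 h1)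
  have X4 : ∀ i ≤ b, x ≠ r i := by
    intro i h1 h
    rcases Nat.eq_zero_or_pos i with h0 | h0
    · subst h0; rw [r0] at h; exact xn'.ne h
    · exact xK2 (h ▸ rK2 i h0 h1)
  -- walks
  have W1 : ∀ i ≤ a, ∃ P : G.Walk x (p i), IsInducedPathW G P ∧ P.length = i + 1 ∧
      ∀ w, w ∈ P.support ↔ w = x ∨ ∃ k ≤ i, w = p k := by
    intro i hi
    obtain ⟨P, h1, h2, h3⟩ := walk_of_indP hp 0 i (by omega) hi
    refine ⟨Walk.cons (by rw [p0]; exact xn) P, ind_cons h1 _ ?_ ?_, by simp [h2], ?_⟩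
    · rw [h3]; rintro ⟨k, -, hk, h⟩; exact X3 k (by omega) h
    · intro w hw hxw
      obtain ⟨k, -, hk, rfl⟩ := (h3 w).1 hw
      rw [X1 k (by omega) hxw]
    · intro w
      rw [Walk.support_cons, List.mem_cons, h3]; simp
  have W3 : ∃ P : G.Walk x (r j), IsInducedPathW G P ∧ P.length = j + 1 ∧
      ∀ w, w ∈ P.support ↔ w = x ∨ ∃ k ≤ j, w = r k := by
    obtain ⟨P, h1, h2, h3⟩ := walk_of_indP hr 0 j (by omega) (by omega)
    refine ⟨Walk.cons (by rw [r0]; exact xn') P, ind_cons h1 _ ?_ ?_, by simp [h2], ?_⟩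
    · rw [h3]; rintro ⟨k, -, hk, h⟩; exact X4 k (by omega) h
    · intro w hw hxw
      obtain ⟨k, -, hk, rfl⟩ := (h3 w).1 hw
      rw [X2 k (by omega) hxw]
    · intro w
      rw [Walk.support_cons, List.mem_cons, h3]; simp
  have W2 : ∀ i, 1 ≤ i → i ≤ a → ∃ P : G.Walk x (p i), IsInducedPathW G P ∧ 2 ≤ P.length ∧
      ∀ w, w ∈ P.support ↔ w = x ∨ w = q ∨ ∃ k, i ≤ k ∧ k ≤ a ∧ w = p k := by
    intro i hi1 hi
    obtain ⟨P, h1, h2, h3⟩ := walk_of_indP hp i a hi le_rfl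
    have hh := ind_rev h1
    have h3' : ∀ w, w ∈ P.reverse.support ↔ ∃ k, i ≤ k ∧ k ≤ a ∧ w = p k := by
      intro w; rw [Walk.support_reverse, List.mem_reverse, h3]
    have qpa : G.Adj q (p a) := by rw [pa]; exact qq2
    refine ⟨Walk.cons xq (Walk.cons qpa P.reverse), ind_cons (ind_cons hh _ ?_ ?_) _ ?_ ?_, by simp, ?_⟩
    · rw [h3']; rintro ⟨k, -, hk, h⟩; exact Q3 k (by omega) h
    · intro w hw hxw
      obtain ⟨k, -, hk, rfl⟩ := (h3' w).1 hw
      rw [Q1 k (by omega) hxw]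
    · rw [Walk.support_cons, List.mem_cons, h3']
      rintro (h | ⟨k, -, hk, h⟩)
      · exact xq.ne h
      · exact X3 k (by omega) h
    · intro w hw hxw
      rw [Walk.support_cons, List.mem_cons, h3'] at hw
      rcases hw with h | ⟨k, h4, hk, rfl⟩
      · exact h
      · have := X1 k hk hxw; omega
    · intro w
      rw [Walk.support_cons, List.mem_cons, Walk.support_cons, List.mem_cons, h3']
  -- min and max
  obtain ⟨i0, hi0, hi0min⟩ : ∃ i, (1 ≤ i ∧ i ≤ a ∧ G.Adj (r j) (p i)) ∧
      ∀ k, 1 ≤ k → k ≤ a → G.Adj (r j) (p k) → i ≤ k :=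
    ⟨Nat.find hj, Nat.find_spec hj, fun k h1 h2 h3 => Nat.find_min' hj ⟨h1, h2, h3⟩⟩
  obtain ⟨i1, hi1, hi1max⟩ : ∃ i, (1 ≤ i ∧ i ≤ a ∧ G.Adj (r j) (p i)) ∧
      ∀ k, 1 ≤ k → k ≤ a → G.Adj (r j) (p k) → k ≤ i := by
    obtain ⟨i, h1, h2, h3⟩ := hj
    let P : ℕ → Prop := fun k => 1 ≤ k ∧ k ≤ a ∧ G.Adj (r j) (p k)
    refine ⟨Nat.findGreatest P a, Nat.findGreatest_spec (P := P) h2 ⟨h1, h2, h3⟩, ?_⟩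
    intro k h4 h5 h6
    exact Nat.le_findGreatest (P := P) h5 ⟨h4, h5, h6⟩
  have hi01 : i0 ≤ i1 := hi0min _ hi1.1 hi1.2.1 hi1.2.2
  have hmm : ∀ k ≤ a, G.Adj (r j) (p k) → i0 ≤ k ∧ k ≤ i1 := by
    intro k h1 h2
    have : 1 ≤ k := by
      by_contra h
      have : k = 0 := by omega
      subst this
      exact F0 j (by omega) h2
    exact ⟨hi0min k this h1 h2, hi1max k this h1 h2⟩
  have RP : ∀ i' ≤ j, ∀ i ≤ a, G.Adj (r i') (p i) → i' = j ∧ i0 ≤ i ∧ i ≤ i1 := by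
    intro i' h1 i h2 h
    have : i' = j := by
      by_contra hne
      exact F1 i' (by omega) i h2 h
    subst this
    exact ⟨rfl, hmm i h2 h⟩
  have PP : ∀ i k, i < k → k ≤ a → (p i ≠ p k) := fun i k h1 h2 h => by
    have := hp.1 i (by omega) k h2 h; omega
  obtain ⟨P3, c31, c32, c33⟩ := W3
  obtain ⟨P1, c11, c12, c13⟩ := W1 i0 hi0.2.1
  obtain ⟨P2, c21, c22, c23⟩ := W2 i1 hi1.1 hi1.2.1
  rcases (show i1 = i0 ∨ i1 = i0 + 1 ∨ i0 + 2 ≤ i1 by omega) with h | h | h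
  · left
    subst h
    obtain ⟨P4, c41, c42, c43⟩ := ind_snoc c31 hi0.2.2
      (by
        rw [c33]; rintro (h | ⟨k, hk, h⟩)
        · exact X3 _ hi0.2.1 h.symm
        · exact F2 k hk _ hi0.2.1 h.symm)
      (by
        intro w hw hadj
        rcases (c33 w).1 hw with rfl | ⟨k, hk, rfl⟩
        · have := X1 _ hi0.2.1 hadj.symm; omega
        · rw [(RP k hk _ hi0.2.1 hadj.symm).1])
    refine theta_of P1 P2 P4 {w | ∃ k < i1, w = p k} {w | w = q ∨ ∃ k, i1 < k ∧ k ≤ a ∧ w = p k}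
      {w | ∃ k ≤ j, w = r k} (X3 _ hi0.2.1) (fun h => by have := X1 _ hi0.2.1 h; omega) c11 c21 c41
      (by omega) c22 (by omega) ?_ ?_ ?_ ?_ ?_ ?_
    · intro w hw
      rcases (c13 w).1 hw with h | ⟨k, hk, rfl⟩
      · exact Or.inl h
      · rcases hk.eq_or_lt with rfl | hk
        · exact Or.inr (Or.inl rfl)
        · exact Or.inr (Or.inr ⟨k, hk, rfl⟩)
    · intro w hw
      rcases (c23 w).1 hw with h | h | ⟨k, hk1, hk2, rfl⟩
      · exact Or.inl h
      · exact Or.inr (Or.inr (Or.inl h))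
      · rcases hk1.eq_or_lt with rfl | hk
        · exact Or.inr (Or.inl rfl)
        · exact Or.inr (Or.inr (Or.inr ⟨k, hk, hk2, rfl⟩))
    · intro w hw
      rcases (c43 w).1 hw with h | h
      · exact Or.inr (Or.inl h)
      · rcases (c33 w).1 h with h | h
        · exact Or.inl h
        · exact Or.inr (Or.inr h)
    · rintro w ⟨k, hk, rfl⟩ w' (rfl | ⟨k', h1, h2, rfl⟩)
      · exact ⟨(Q3 k (by omega)).symm, fun h => by have := Q1 k (by omega) h.symm; omega⟩
      · exact ⟨PP k k' (by omega) h2, fun h => by have := (hp.2 k k' (by omega) h2).1 h; omega⟩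
    · rintro w ⟨k, hk, rfl⟩ w' ⟨k', h1, rfl⟩
      exact ⟨(F2 k' h1 k (by omega)).symm, fun h => by have := RP k' h1 k (by omega) h.symm; omega⟩
    · rintro w (rfl | ⟨k, hk, hk2, rfl⟩) w' ⟨k', h1, rfl⟩
      · exact ⟨Q4 k' h1, Q2 k' h1⟩
      · exact ⟨(F2 k' h1 k (by omega)).symm, fun h => by have := RP k' h1 k (by omega) h.symm; omega⟩
  · right
    subst h
    refine pyr_of P1 P2 P3 {w | ∃ k ≤ i0, w = p k} {w | w = q ∨ ∃ k, i0 + 1 ≤ k ∧ k ≤ a ∧ w = p k}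
      {w | ∃ k ≤ j, w = r k} ((hp.2 _ _ (by omega) (by omega)).2 rfl) hi0.2.2.symm hi1.2.2.symm
      c11 c21 c31 (by omega) c22 (by omega) (fun w hw => (c13 w).1 hw)
      (fun w hw => (c23 w).1 hw) (fun w hw => (c33 w).1 hw) ?_ ?_ ?_
    · rintro w ⟨k, hk, rfl⟩ w' (rfl | ⟨k', h1, h2, rfl⟩)
      · exact ⟨(Q3 k (by omega)).symm, fun h => by have := Q1 k (by omega) h.symm; omega⟩
      · refine ⟨PP k k' (by omega) h2, fun h => ?_⟩
        have := (hp.2 k k' (by omega) h2).1 h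
        have e : k = i0 := by omega
        subst e; subst this; exact ⟨rfl, rfl⟩
    · rintro w ⟨k, hk, rfl⟩ w' ⟨k', h1, rfl⟩
      refine ⟨(F2 k' h1 k (by omega)).symm, fun h => ?_⟩
      have := RP k' h1 k (by omega) h.symm
      have e : k = i0 := by omega
      subst e; rw [this.1]; exact ⟨rfl, rfl⟩
    · rintro w (rfl | ⟨k, hk, hk2, rfl⟩) w' ⟨k', h1, rfl⟩
      · exact ⟨Q4 k' h1, fun h => absurd h (Q2 k' h1)⟩
      · refine ⟨(F2 k' h1 k (by omega)).symm, fun h => ?_⟩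
        have := RP k' h1 k (by omega) h.symm
        have e : k = i0 + 1 := by omega
        subst e; rw [this.1]; exact ⟨rfl, rfl⟩
  · left
    obtain ⟨P4, c41, c42, c43⟩ := ind_snoc c11 hi0.2.2.symm
      (by
        rw [c13]; rintro (h | ⟨k, hk, h⟩)
        · exact X4 _ (by omega) h.symm
        · exact F2 j le_rfl k (by omega) h)
      (by
        intro w hw hadj
        rcases (c13 w).1 hw with rfl | ⟨k, hk, rfl⟩
        · have := X2 _ (by omega) hadj.symm; omega
        · have := RP j le_rfl k (by omega) hadj
          rw [show k = i0 by omega])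
    obtain ⟨P5, c51, c52, c53⟩ := ind_snoc c21 hi1.2.2.symm
      (by
        rw [c23]; rintro (h | h | ⟨k, hk, hk2, h⟩)
        · exact X4 _ (by omega) h.symm
        · exact Q4 _ le_rfl h.symm
        · exact F2 j le_rfl k (by omega) h)
      (by
        intro w hw hadj
        rcases (c23 w).1 hw with rfl | rfl | ⟨k, hk, hk2, rfl⟩
        · have := X2 _ (by omega) hadj.symm; omega
        · exact absurd hadj.symm (Q2 j le_rfl)
        · have := RP j le_rfl k (by omega) hadj
          rw [show k = i1 by omega])
    refine theta_of P4 P5 P3 {w | ∃ k ≤ i0, w = p k} {w | w = q ∨ ∃ k, i1 ≤ k ∧ k ≤ a ∧ w = p k}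
      {w | ∃ k < j, w = r k} (X4 _ (by omega)) (fun h => by have := X2 _ (by omega) h; omega) c41 c51 c31
      (by omega) (by omega) (by omega) ?_ ?_ ?_ ?_ ?_ ?_
    · intro w hw
      rcases (c43 w).1 hw with h | h
      · exact Or.inr (Or.inl h)
      · rcases (c13 w).1 h with h | h
        · exact Or.inl h
        · exact Or.inr (Or.inr h)
    · intro w hw
      rcases (c53 w).1 hw with h | h
      · exact Or.inr (Or.inl h)
      · rcases (c23 w).1 h with h | h
        · exact Or.inl h
        · exact Or.inr (Or.inr h)
    · intro w hw
      rcases (c33 w).1 hw with h | ⟨k, hk, rfl⟩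
      · exact Or.inl h
      · rcases hk.eq_or_lt with rfl | hk
        · exact Or.inr (Or.inl rfl)
        · exact Or.inr (Or.inr ⟨k, hk, rfl⟩)
    · rintro w ⟨k, hk, rfl⟩ w' (rfl | ⟨k', h1, h2, rfl⟩)
      · exact ⟨(Q3 k (by omega)).symm, fun h => by have := Q1 k (by omega) h.symm; omega⟩
      · exact ⟨PP k k' (by omega) h2, fun h => by have := (hp.2 k k' (by omega) h2).1 h; omega⟩
    · rintro w ⟨k, hk, rfl⟩ w' ⟨k', h1, rfl⟩
      exact ⟨(F2 k' (by omega) k (by omega)).symm, fun h => F1 k' h1 k (by omega) h.symm⟩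
    · rintro w (rfl | ⟨k, hk, hk2, rfl⟩) w' ⟨k', h1, rfl⟩
      · exact ⟨Q4 k' (by omega), Q2 k' (by omega)⟩
      · exact ⟨(F2 k' (by omega) k (by omega)).symm, fun h => F1 k' h1 k (by omega) h.symm⟩

lemma JM [Finite V] {r0 c1 : ℕ} (H : Hyp G r0 c1) {ν v : V} {D A : Set V}
    (vD : v ∈ D) (νD : ν ∉ D) (hν : ∀ w ∈ D, ¬ G.Adj ν w)
    (hA : ∀ a ∈ A, G.Adj ν a ∧ ¬ G.Adj a v) :
    ∃ N ⊆ A, N.ncard ≤ r0 ∧ ∀ a ∈ A, ∀ w ∈ comp G {w | w ∈ D ∧ ∀ n ∈ N, ¬ G.Adj n w} v,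
      ¬ G.Adj a w := by
  set KK : Set V → Set V := fun N => comp G {w | w ∈ D ∧ ∀ n ∈ N, ¬ G.Adj n w} v with hKK
  obtain ⟨N, ⟨hNA, hNc⟩, hmin⟩ := Set.exists_min_image {N : Set V | N ⊆ A ∧ N.ncard ≤ r0}
    (fun N => (KK N).ncard) (Set.toFinite _) ⟨∅, by simp, by simp⟩
  refine ⟨N, hNA, hNc, ?_⟩
  by_contra hcon
  push Not at hcon
  obtain ⟨a, haA, w, hw, haw⟩ := hcon
  have anti : ∀ M M' : Set V, M ⊆ M' → KK M' ⊆ KK M := by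
    intro M M' h z hz
    exact Cn.mono hz fun y hy => ⟨hy.1, fun n hn => hy.2 n (h hn)⟩
  have vK : ∀ M ⊆ A, v ∈ KK M := fun M hM => mem_comp_self ⟨vD, fun n hn => (hA n (hM hn)).2⟩
  have strict : ∀ M ⊆ A, M.ncard ≤ r0 → a ∈ M → ¬ KK M ⊆ KK N := by
    intro M hM hMc haM hsub
    have h1 := hmin M ⟨hM, hMc⟩
    have h2 := Set.eq_of_subset_of_ncard_le hsub h1 (Set.toFinite _)
    have h3 : w ∈ KK M := by rw [h2]; exact hw
    exact (comp_sub h3).2 a haM haw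
  have hNr : r0 ≤ N.ncard := by
    by_contra h
    refine strict (insert a N) (Set.insert_subset haA hNA) ?_ (by simp) (anti _ _ (Set.subset_insert _ _))
    have := Set.ncard_insert_le a N
    omega
  have hE : ∀ n ∈ N, ∃ e ∈ D, G.Adj n e ∧ (∀ n' ∈ N, n' ≠ n → ¬ G.Adj n' e) ∧ ∃ d ∈ KK N, G.Adj e d := by
    intro n hn
    have hM : insert a (N \ {n}) ⊆ A := Set.insert_subset haA (Set.sdiff_subset.trans hNA)
    have hMc : (insert a (N \ {n})).ncard ≤ r0 := by
      have h1 := Set.ncard_insert_le a (N \ {n})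
      have h2 := Set.ncard_sdiff_singleton_add_one hn (Set.toFinite _)
      omega
    have hns := strict _ hM hMc (by simp)
    have hns' : ¬ KK (N \ {n}) ⊆ KK N := fun h => hns ((anti _ _ (Set.subset_insert _ _)).trans h)
    obtain ⟨z, hz1, hz2⟩ := Set.not_subset.1 hns'
    obtain ⟨d, e, h1, h2, h3, h4, h5⟩ := (comp_CS (G := G)).cross
      (vK _ (Set.sdiff_subset.trans hNA)) hz1 (vK N hNA) hz2
    have h6 := comp_sub h3
    refine ⟨e, h6.1, ?_, fun n' hn' hne => h6.2 n' ⟨hn', hne⟩, d, h2, h5.symm⟩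
    by_contra hne
    apply h4
    refine comp_step h2 h5 ⟨h6.1, fun n' hn' => ?_⟩
    by_cases h : n' = n
    · rw [h]; exact hne
    · exact h6.2 n' ⟨hn', h⟩
  obtain ⟨I, hI, hIc, hIs⟩ := H.st3 N hNr
  obtain ⟨n1, n2, n3, d12, d13, d23, rfl⟩ := Set.ncard_eq_three.1 hIc
  have m1 : n1 ∈ N := hI (by simp)
  have m2 : n2 ∈ N := hI (by simp)
  have m3 : n3 ∈ N := hI (by simp)
  obtain ⟨e1, e1D, a1, b1, f1, f1K, g1⟩ := hE n1 m1
  obtain ⟨e2, e2D, a2, b2, f2, f2K, g2⟩ := hE n2 m2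
  obtain ⟨e3, e3D, a3, b3, f3, f3K, g3⟩ := hE n3 m3
  have hKs : ∀ w ∈ KK N, w ∈ D ∧ ∀ n ∈ N, ¬ G.Adj n w := fun w hw => by
    have := comp_sub hw
    exact this
  have c3 : CS G (insert e3 (KK N)) := comp_CS.ins f3K g3
  have D1 : ∀ w ∈ insert e1 (insert e3 (KK N)), w ∈ D := by
    rintro w (rfl | rfl | h)
    exacts [e1D, e3D, (hKs w h).1]
  have D2 : ∀ w ∈ insert e2 (insert e3 (KK N)), w ∈ D := by
    rintro w (rfl | rfl | h)
    exacts [e2D, e3D, (hKs w h).1]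
  have := lemmaB (G := G) (x := ν) (n := n1) (n' := n2) (q := n3) (q2 := e3)
    (K1 := insert e1 (insert e3 (KK N))) (K2 := insert e2 (insert e3 (KK N)))
    (c3.ins (Or.inr f1K) g1) (c3.ins (Or.inr f2K) g2) (by simp) (by simp)
    (fun h => νD (D1 _ h)) (fun h => νD (D2 _ h)) (fun w hw => hν w (D1 w hw))
    (fun w hw => hν w (D2 w hw)) (hA n1 (hNA m1)).1 (hA n2 (hNA m2)).1 (hA n3 (hNA m3)).1
    (hIs _ (by simp) _ (by simp)) (hIs _ (by simp) _ (by simp)) (hIs _ (by simp) _ (by simp))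
    ⟨e1, by simp, a1⟩ (by
      rintro w (rfl | rfl | h)
      exacts [b1 _ m2 d12.symm, b3 _ m2 d23, (hKs w h).2 _ m2])
    ⟨e2, by simp, a2⟩ (by
      rintro w (rfl | rfl | h)
      exacts [b2 _ m1 d12, b3 _ m1 d13, (hKs w h).2 _ m1])
    a3 (by
      rintro w (rfl | rfl | h) h'
      exacts [absurd h' (b1 _ m3 d13.symm), rfl, absurd h' ((hKs w h).2 _ m3)])
    (by
      rintro w (rfl | rfl | h) h'
      exacts [absurd h' (b2 _ m3 d23.symm), rfl, absurd h' ((hKs w h).2 _ m3)])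
  exact this.elim H.th H.py

/-- anchored state -/
structure Anch (G : SimpleGraph V) (x q q2 : V) (Ω Θ R : Set V) (k : ℕ) : Prop where
  cs : CS G Ω
  q2m : q2 ∈ Ω
  xΩ : x ∉ Ω
  nxΩ : ∀ w ∈ Ω, ¬ G.Adj x w
  xq : G.Adj x q
  qq2 : G.Adj q q2
  qΩ : ∀ w ∈ Ω, G.Adj q w → w = q2
  dis : ∀ w ∈ R, w ∉ Ω
  xR : x ∉ R
  qR : q ∉ R
  nqR : ∀ w ∈ R, ¬ G.Adj q w
  att : ∀ w ∈ R, (∃ o ∈ Ω, G.Adj w o) → ∃ θ ∈ Θ, G.Adj w θ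
  nxΘ : ∀ θ ∈ Θ, x ≠ θ ∧ ¬ G.Adj x θ
  stΘ : ∀ w ∈ R, G.Adj x w → ∀ θ ∈ Θ, ¬ G.Adj w θ
  kΘ : Θ.ncard ≤ k

def Sp (G : SimpleGraph V) (x : V) (Ω R Z : Set V) : Prop :=
  Z ⊆ R ∧ ∀ n m, G.Adj x n → (∃ o ∈ Ω, G.Adj m o) → ¬ Cn G (R \ Z) n m

def CC (G : SimpleGraph V) (x q2 : V) (Ω R : Set V) : Set V :=
  comp G ({w | w ∈ R ∧ ¬ G.Adj x w} ∪ Ω) q2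

def KN (G : SimpleGraph V) (q2 : V) (C : Set V) (n : V) : Set V :=
  comp G {w | w ∈ C ∧ ¬ G.Adj n w} q2

section
variable {x q q2 : V} {Ω Θ R : Set V} {k : ℕ}

lemma Anch.start (A : Anch G x q q2 Ω Θ R k) {n : V} (hn : n ∈ R) (hx : G.Adj x n) :
    ∀ o ∈ Ω, ¬ G.Adj n o := fun o ho h => by
  obtain ⟨θ, h1, h2⟩ := A.att n hn ⟨o, ho, h⟩
  exact A.stΘ n hn hx θ h1 h2

lemma Anch.ΩC (A : Anch G x q q2 Ω Θ R k) : Ω ⊆ CC G x q2 Ω R :=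
  A.cs.sub_comp A.q2m Set.subset_union_right

lemma Anch.nxC (A : Anch G x q q2 Ω Θ R k) : ∀ w ∈ CC G x q2 Ω R, ¬ G.Adj x w := by
  intro w hw
  rcases comp_sub hw with h | h
  · exact h.2
  · exact A.nxΩ w h

lemma Anch.xC (A : Anch G x q q2 Ω Θ R k) : x ∉ CC G x q2 Ω R := by
  intro hw
  rcases comp_sub hw with h | h
  · exact A.xR h.1
  · exact A.xΩ h

lemma Anch.qC (A : Anch G x q q2 Ω Θ R k) : ∀ w ∈ CC G x q2 Ω R, G.Adj q w → w = q2 := by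
  intro w hw hq
  rcases comp_sub hw with h | h
  · exact absurd hq (A.nqR w h.1)
  · exact A.qΩ w h hq

lemma Anch.ΩK (A : Anch G x q q2 Ω Θ R k) {n : V} (hn : n ∈ R) (hx : G.Adj x n) :
    Ω ⊆ KN G q2 (CC G x q2 Ω R) n :=
  A.cs.sub_comp A.q2m fun o ho => ⟨A.ΩC ho, A.start hn hx o ho⟩

lemma KN_sub {C : Set V} {n w : V} (h : w ∈ KN G q2 C n) : w ∈ C ∧ ¬ G.Adj n w := by
  have := comp_sub h
  exact this

lemma Anch.comparable {r0 c1 : ℕ} (H : Hyp G r0 c1) (A : Anch G x q q2 Ω Θ R k) {n n' : V}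
    (hn : n ∈ R) (hx : G.Adj x n) (hn' : n' ∈ R) (hx' : G.Adj x n') (hnn : ¬ G.Adj n n') :
    KN G q2 (CC G x q2 Ω R) n ⊆ KN G q2 (CC G x q2 Ω R) n' ∨
    KN G q2 (CC G x q2 Ω R) n' ⊆ KN G q2 (CC G x q2 Ω R) n := by
  by_contra hcon
  push Not at hcon
  obtain ⟨h1, h2⟩ := hcon
  have hq := A.ΩK hn hx A.q2m
  have hq' := A.ΩK hn' hx' A.q2m
  have e1 : ∃ w ∈ KN G q2 (CC G x q2 Ω R) n', G.Adj n w := by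
    by_contra h
    push Not at h
    exact h2 (CS.sub_comp comp_CS hq' fun w hw => ⟨(KN_sub hw).1, h w hw⟩)
  have e2 : ∃ w ∈ KN G q2 (CC G x q2 Ω R) n, G.Adj n' w := by
    by_contra h
    push Not at h
    exact h1 (CS.sub_comp comp_CS hq fun w hw => ⟨(KN_sub hw).1, h w hw⟩)
  have := lemmaB (G := G) (x := x) (n := n) (n' := n') (q := q) (q2 := q2)
    (K1 := KN G q2 (CC G x q2 Ω R) n') (K2 := KN G q2 (CC G x q2 Ω R) n) comp_CS comp_CS hq' hq
    (fun h => A.xC (KN_sub h).1) (fun h => A.xC (KN_sub h).1)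
    (fun w h => A.nxC w (KN_sub h).1) (fun w h => A.nxC w (KN_sub h).1) hx hx' A.xq hnn
    (fun h => A.nqR n hn h.symm) (fun h => A.nqR n' hn' h.symm) e1 (fun w h => (KN_sub h).2)
    e2 (fun w h => (KN_sub h).2) A.qq2 (fun w h => A.qC w (KN_sub h).1)
    (fun w h => A.qC w (KN_sub h).1)
  exact this.elim H.th H.py

lemma Anch.core [Finite V] {r0 c1 : ℕ} (H : Hyp G r0 c1) (A : Anch G x q q2 Ω Θ R k)
    (hne : ∃ n ∈ R, G.Adj x n ∧ ∃ c ∈ CC G x q2 Ω R, G.Adj n c) :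
    ∃ ν ∈ R, G.Adj x ν ∧ ∃ E ⊆ R, E.ncard ≤ c1 ∧ (∀ e ∈ E, G.Adj x e) ∧
      ∀ n ∈ R, G.Adj x n → n ∉ E → ∀ w ∈ KN G q2 (CC G x q2 Ω R) ν, ¬ G.Adj n w := by
  set C := CC G x q2 Ω R with hC
  set St : Set V := {n | n ∈ R ∧ G.Adj x n ∧ ∃ c ∈ C, G.Adj n c} with hSt
  set Good : V → Set V := fun ν => {n | n ∈ St ∧ KN G q2 C ν ⊆ KN G q2 C n} with hGood
  obtain ⟨ν, hν, hmax⟩ := Set.exists_max_image St (fun n => (Good n).ncard) (Set.toFinite _)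
    (by obtain ⟨n, h1, h2, h3⟩ := hne; exact ⟨n, h1, h2, h3⟩)
  refine ⟨ν, hν.1, hν.2.1, St \ Good ν, fun n hn => hn.1.1, ?_, fun n hn => hn.1.2.1, ?_⟩
  · by_contra hcon
    obtain ⟨I, hI, hIc, hIs⟩ := H.st (St \ Good ν) (by omega)
    have hr2 := H.r2
    obtain ⟨n0, hn0, hn0min⟩ := Set.exists_min_image I (fun n => (KN G q2 C n).ncard) (Set.toFinite _)
      (by apply Set.nonempty_of_ncard_ne_zero; omega)
    have hIG : I ⊆ Good n0 := by
      intro n hn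
      refine ⟨(hI hn).1, ?_⟩
      rcases A.comparable H (hI hn0).1.1 (hI hn0).1.2.1 (hI hn).1.1 (hI hn).1.2.1 (hIs _ hn0 _ hn) with h | h
      · exact h
      · exact (Set.eq_of_subset_of_ncard_le h (hn0min n hn) (Set.toFinite _)).symm.subset
    have h1 := hmax n0 (hI hn0).1
    have h2 : I ⊆ Good n0 \ Good ν := fun n hn => ⟨hIG hn, (hI hn).2⟩
    have h3 := Set.ncard_le_ncard h2 (Set.toFinite _)
    have h4 := Set.ncard_inter_add_ncard_sdiff_eq_ncard (Good n0) (Good ν) (Set.toFinite _)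
    have h5 := Set.ncard_inter_add_ncard_sdiff_eq_ncard (Good ν) (Good n0) (Set.toFinite _)
    rw [Set.inter_comm] at h5
    have hJ : r0 ≤ (Good ν \ Good n0).ncard := by omega
    have hadj : ∀ i ∈ I, ∀ j ∈ Good ν \ Good n0, G.Adj i j := by
      intro i hi j hj
      by_contra hij
      rcases A.comparable H (hI hi).1.1 (hI hi).1.2.1 hj.1.1.1 hj.1.1.2.1 hij with h | h
      · exact hj.2 ⟨hj.1.1, (hIG hi).2.trans h⟩
      · exact (hI hi).2 ⟨(hI hi).1, hj.1.2.trans h⟩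
    obtain ⟨i1, i2, hi1, hi2, h12⟩ := (Set.one_lt_ncard_iff (s := I) (Set.toFinite _)).1 (by omega)
    have h6 := H.cnb h12 (hIs _ hi1 _ hi2)
    have h7 : Good ν \ Good n0 ⊆ {w | G.Adj i1 w ∧ G.Adj i2 w} := fun j hj => ⟨hadj _ hi1 j hj, hadj _ hi2 j hj⟩
    have h8 := Set.ncard_le_ncard h7 (Set.toFinite _)
    omega
  · intro n hn hx hnE w hw
    by_cases hnS : n ∈ St
    · have : n ∈ Good ν := by
        by_contra h; exact hnE ⟨hnS, h⟩
      exact (KN_sub (this.2 hw)).2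
    · intro h
      exact hnS ⟨hn, hx, w, (KN_sub hw).1, h⟩

lemma Anch.triv (A : Anch G x q q2 Ω Θ R k)
    (hne : ¬ ∃ n ∈ R, G.Adj x n ∧ ∃ c ∈ CC G x q2 Ω R, G.Adj n c) : Sp G x Ω R ∅ := by
  refine ⟨Set.empty_subset _, ?_⟩
  rintro n m hxn ⟨o, ho, hmo⟩ hcn
  rw [Set.sdiff_empty] at hcn
  have hmR := hcn.right
  have nxm : ¬ G.Adj x m := fun h => A.start hmR h o ho hmo
  have hmC : m ∈ CC G x q2 Ω R := comp_step (A.ΩC ho) hmo.symm (Or.inl ⟨hmR, nxm⟩)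
  obtain ⟨d, e, h1, h2, h3, h4⟩ := hcn.symm.exit hmC (fun h => A.nxC n h hxn)
  apply hne
  refine ⟨e, h3, ?_, d, h1.right.2, h2.symm⟩
  by_contra h
  exact h4 (comp_step h1.right.2 h2 (Or.inl ⟨h3, h⟩))

def R' (G : SimpleGraph V) (x q2 : V) (Ω Θ R : Set V) (ν : V) : Set V :=
  {a | a ∈ R ∧ (a ∈ KN G q2 (CC G x q2 Ω R) ν ∨
    (a ∈ CC G x q2 Ω R ∧ G.Adj ν a ∧ ∀ θ ∈ Θ, ¬ G.Adj a θ))}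

def Del (G : SimpleGraph V) (Θ R : Set V) (ν : V) : Set V :=
  {a | a ∈ R ∧ G.Adj ν a ∧ ∃ θ ∈ Θ, G.Adj a θ}

lemma del_card [Finite V] {r0 c1 : ℕ} (H : Hyp G r0 c1) {ν : V} (hν : ∀ θ ∈ Θ, ν ≠ θ ∧ ¬ G.Adj ν θ)
    (hk : Θ.ncard ≤ k) : (Del G Θ R ν).ncard ≤ k * r0 := by
  have hfin := Set.toFinite Θ
  have h1 : Del G Θ R ν ⊆ ⋃ θ ∈ hfin.toFinset, {w | G.Adj ν w ∧ G.Adj θ w} := by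
    rintro a ⟨-, h, θ, h1, h2⟩
    simp only [Set.mem_iUnion]
    exact ⟨θ, by simpa using h1, h, h2.symm⟩
  have h2 := Set.ncard_le_ncard h1 (Set.toFinite _)
  have h3 := Finset.set_ncard_biUnion_le hfin.toFinset (fun θ => {w | G.Adj ν w ∧ G.Adj θ w})
  have h4 : ∑ θ ∈ hfin.toFinset, ({w | G.Adj ν w ∧ G.Adj θ w} : Set V).ncard ≤ ∑ θ ∈ hfin.toFinset, r0 := by
    apply Finset.sum_le_sum
    intro θ hθ
    have := hν θ (by simpa using hθ)
    exact (H.cnb this.1 this.2).le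
  rw [Finset.sum_const, ← Set.ncard_eq_toFinset_card Θ hfin, smul_eq_mul] at h4
  have := Nat.mul_le_mul_right r0 hk
  omega

lemma Anch.R'C {ν : V} {a : V} (h : a ∈ R' G x q2 Ω Θ R ν) : a ∈ CC G x q2 Ω R := by
  rcases h.2 with h | h
  · exact (KN_sub h).1
  · exact h.1

lemma Anch.step (A : Anch G x q q2 Ω Θ R k) {ν : V} (hν : ν ∈ R) (hx : G.Adj x ν) :
    Anch G ν x q (insert q Ω) Θ (R' G x q2 Ω Θ R ν) k where
  cs := A.cs.ins A.q2m A.qq2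
  q2m := Or.inl rfl
  xΩ := by
    rintro (h | h)
    · exact A.qR (h ▸ hν)
    · exact A.dis ν hν h
  nxΩ := by
    rintro w (h | h) h'
    · exact A.nqR ν hν (h ▸ h'.symm)
    · exact A.start hν hx w h h'
  xq := hx.symm
  qq2 := A.xq
  qΩ := by
    rintro w (h | h) h'
    · exact h
    · exact absurd h' (A.nxΩ w h)
  dis := by
    rintro w hw (h | h)
    · exact A.qR (h ▸ hw.1)
    · exact A.dis w hw.1 h
  xR := fun h => A.nxC _ (Anch.R'C h) hx
  qR := fun h => A.xR h.1
  nqR := fun w hw => A.nxC w (Anch.R'C hw)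
  att := by
    rintro w hw ⟨o, (h | h), h'⟩
    · exact absurd (h ▸ h'.symm) (A.nqR w hw.1)
    · exact A.att w hw.1 ⟨o, h, h'⟩
  nxΘ := fun θ hθ => ⟨fun h => (A.nxΘ θ hθ).2 (h ▸ hx), A.stΘ ν hν hx θ hθ⟩
  stΘ := by
    intro w hw h θ hθ
    rcases hw.2 with h1 | h1
    · exact absurd h (KN_sub h1).2
    · exact h1.2.2 θ hθ
  kΘ := A.kΘ

lemma Anch.transfer (A : Anch G x q q2 Ω Θ R k) {ν : V} (hν : ν ∈ R) (hx : G.Adj x ν) {E Z : Set V}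
    (hER : E ⊆ R)
    (hE : ∀ n ∈ R, G.Adj x n → n ∉ E → ∀ w ∈ KN G q2 (CC G x q2 Ω R) ν, ¬ G.Adj n w)
    (hZ : Sp G ν (insert q Ω) (R' G x q2 Ω Θ R ν) Z) :
    Sp G x Ω R (Z ∪ E ∪ Del G Θ R ν) := by
  refine ⟨?_, ?_⟩
  · rintro a ((h | h) | h)
    · exact (hZ.1 h).1
    · exact hER h
    · exact h.1
  rintro n m hxn ⟨o, ho, hmo⟩ hcn
  have hmR := hcn.right
  have nxm : ¬ G.Adj x m := fun h => A.start hmR.1 h o ho hmo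
  have hmC : m ∈ CC G x q2 Ω R := comp_step (A.ΩC ho) hmo.symm (Or.inl ⟨hmR.1, nxm⟩)
  obtain ⟨d, e, h1, h2, h3, h4⟩ := hcn.symm.exit hmC (fun h => A.nxC n h hxn)
  have hxe : G.Adj x e := by
    by_contra h
    exact h4 (comp_step h1.right.2 h2 (Or.inl ⟨h3.1, h⟩))
  have heE : e ∉ E := fun h => h3.2 (Or.inl (Or.inr h))
  have hdK : d ∉ KN G q2 (CC G x q2 Ω R) ν := fun h => hE e h3.1 hxe heE d h h2.symm
  have nνm : ¬ G.Adj ν m := fun h => by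
    refine hmR.2 (Or.inr ⟨hmR.1, h, A.att m hmR.1 ⟨o, ho, hmo⟩⟩)
  have hmK : m ∈ KN G q2 (CC G x q2 Ω R) ν :=
    comp_step (A.ΩK hν hx ho) hmo.symm ⟨hmC, nνm⟩
  obtain ⟨d', e', k1, k2, k3, k4⟩ := h1.exit hmK hdK
  have hνe : G.Adj ν e' := by
    by_contra h
    exact k4 (comp_step k1.right.2 k2 ⟨k3.2, h⟩)
  have he'R : e' ∈ R' G x q2 Ω Θ R ν := by
    refine ⟨k3.1.1, Or.inr ⟨k3.2, hνe, fun θ hθ h => ?_⟩⟩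
    exact k3.1.2 (Or.inr ⟨k3.1.1, hνe, θ, hθ, h⟩)
  refine hZ.2 e' m hνe ⟨o, Or.inr ho, hmo⟩ ?_
  have hsub : R \ (Z ∪ E ∪ Del G Θ R ν) ∩ CC G x q2 Ω R ∩ KN G q2 (CC G x q2 Ω R) ν ⊆
      R' G x q2 Ω Θ R ν \ Z := fun w hw =>
    ⟨⟨hw.1.1.1, Or.inl hw.2⟩, fun h => hw.1.1.2 (Or.inl (Or.inl h))⟩
  exact ((k1.mono hsub).step k2 ⟨he'R, fun h => k3.1.2 (Or.inl (Or.inl h))⟩).symm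
end

lemma Cn.exit2 {A K : Set V} {m n : V} (h : Cn G A m n) (hm : m ∈ K) :
    Cn G (A ∩ K) m n ∨ ∃ d e, Cn G (A ∩ K) m d ∧ G.Adj d e ∧ e ∈ A ∧ e ∉ K := by
  by_cases hn : n ∈ K
  · obtain ⟨h1, h2⟩ := h
    by_contra hcon
    push Not at hcon
    obtain ⟨h3, hcon⟩ := hcon
    have : Cn G (A ∩ K) m n := by
      clear hn h3
      induction h2 with
      | refl => exact Cn.refl ⟨h1, hm⟩
      | @tail b c hab hbc ih =>
        exact ih.step hbc.1 ⟨hbc.2, hcon _ _ ih hbc.1 hbc.2⟩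
    exact h3 this
  · exact Or.inr (h.exit hm hn)

lemma log_half {a f : ℕ} (h : 2 * a + 1 ≤ f) (c : ℕ) :
    c * Nat.log 2 (a + 1) + c ≤ c * Nat.log 2 (f + 1) := by
  have h1 : Nat.log 2 ((a + 1) * 2) = Nat.log 2 (a + 1) + 1 := Nat.log_mul_base (by norm_num) (by omega)
  have h2 : Nat.log 2 ((a + 1) * 2) ≤ Nat.log 2 (f + 1) := Nat.log_mono_right (by omega)
  calc c * Nat.log 2 (a + 1) + c = c * (Nat.log 2 (a+1) + 1) := by ring
    _ ≤ _ := Nat.mul_le_mul_left c (by omega)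

section
variable {x q q2 : V} {Ω Θ R : Set V} {k : ℕ}

lemma region1 [Finite V] {r0 c1 : ℕ} (H : Hyp G r0 c1) (hk : 1 ≤ k)
    (A : Anch G x q q2 Ω Θ R k) {ν ν2 : V} (hν : ν ∈ R) (hx : G.Adj x ν)
    {E E' : Set V} (hER : E ⊆ R) (hEc : E.ncard ≤ c1)
    (hE : ∀ n ∈ R, G.Adj x n → n ∉ E → ∀ w ∈ KN G q2 (CC G x q2 Ω R) ν, ¬ G.Adj n w)
    (hν2 : ν2 ∈ R' G x q2 Ω Θ R ν) (hx2 : G.Adj ν ν2)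
    (hER' : E' ⊆ R' G x q2 Ω Θ R ν) (hEc' : E'.ncard ≤ c1)
    (hE' : ∀ n ∈ R' G x q2 Ω Θ R ν, G.Adj ν n → n ∉ E' →
      ∀ w ∈ KN G q (CC G ν q (insert q Ω) (R' G x q2 Ω Θ R ν)) ν2, ¬ G.Adj n w) :
    ∃ R1 Ω1 : Set V, Anch G x q q2 Ω1 {ν2} R1 k ∧
      {w | w ∈ R1 ∧ ¬ G.Adj x w}.ncard +
      {w | w ∈ R' G ν q (insert q Ω) Θ (R' G x q2 Ω Θ R ν) ν2 ∧ ¬ G.Adj ν2 w}.ncard + 1 ≤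
        {w | w ∈ R ∧ ¬ G.Adj x w}.ncard ∧
      ∀ Z, Sp G x Ω1 R1 Z → ∃ Z', Sp G x Ω R Z' ∧ Z'.ncard ≤ Z.ncard + (2 * c1 + (2 * k + 1) * r0 + 1) := by
  have A2 := A.step hν hx
  set C := CC G x q2 Ω R with hC
  set K := KN G q2 C ν with hK
  set Rp := R' G x q2 Ω Θ R ν with hRp
  set C' := CC G ν q (insert q Ω) Rp with hC'
  set K' := KN G q C' ν2 with hK'
  set K2 := KN G q2 K ν2 with hK2
  have ΩK : Ω ⊆ K := A.ΩK hν hx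
  have st2 : ∀ o ∈ insert q Ω, ¬ G.Adj ν2 o := A2.start hν2 hx2
  have ΩK2 : Ω ⊆ K2 := A.cs.sub_comp A.q2m fun o ho => ⟨ΩK ho, st2 o (Or.inr ho)⟩
  have q2K2 : q2 ∈ K2 := ΩK2 A.q2m
  have K2K : K2 ⊆ K := fun w hw => (KN_sub hw).1
  have KC : K ⊆ C := fun w hw => (KN_sub hw).1
  have C'K : ∀ w ∈ C', w = q ∨ w ∈ K := by
    intro w hw
    rcases comp_sub hw with ⟨h1, h2⟩ | h | h
    · rcases h1.2 with h | h
      · exact Or.inr h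
      · exact absurd h.2.1 h2
    · exact Or.inl h
    · exact Or.inr (ΩK h)
  have K'sub : ∀ w ∈ K', w = q ∨ w ∈ K2 := by
    intro w hw
    refine Cn.closed (S := {w | w = q ∨ w ∈ K2}) hw (Or.inl rfl) ?_
    intro d hd e he hde
    rcases C'K e he.1 with h | h
    · exact Or.inl h
    · rcases hd with hd | hd
      · right
        rw [hd] at hde
        rw [A.qC e (KC h) hde]; exact q2K2
      · exact Or.inr (comp_step hd hde ⟨h, he.2⟩)
  have csq : CS G (insert q K2) := (comp_CS : CS G K2).ins q2K2 A.qq2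
  have K2C' : insert q K2 ⊆ C' := by
    refine csq.sub_comp (Or.inl rfl) ?_
    rintro w (h | h)
    · exact Or.inr (Or.inl h)
    · rcases comp_sub (KC (K2K h)) with h1 | h1
      · exact Or.inl ⟨⟨h1.1, Or.inl (K2K h)⟩, (KN_sub (K2K h)).2⟩
      · exact Or.inr (Or.inr h1)
  have K2K' : K2 ⊆ K' := by
    intro w hw
    refine csq.sub_comp (Or.inl rfl) (A := {w | w ∈ C' ∧ ¬ G.Adj ν2 w}) ?_ (Or.inr hw)
    intro z hz
    refine ⟨K2C' hz, ?_⟩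
    rcases hz with h | h
    · rw [h]; exact st2 q (Or.inl rfl)
    · exact (KN_sub h).2
  have ν2C : ν2 ∈ C := Anch.R'C hν2
  have nxν2 : ¬ G.Adj x ν2 := A.nxC _ ν2C
  have xν2 : x ≠ ν2 := fun h => A.xR (h ▸ hν2.1)
  set De := Del G Θ R ν with hDe
  set B : Set V := E ∪ E' ∪ De with hB
  set CNx : Set V := {w | w ∈ R ∧ G.Adj x w ∧ G.Adj ν2 w} with hCN
  set R1 : Set V := {w | w ∈ R ∧ w ∉ K2 ∧ w ∉ B ∧ w ≠ ν2 ∧ (G.Adj x w → ¬ G.Adj w ν2)} with hR1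
  refine ⟨R1, K2, ?_, ?_, ?_⟩
  · refine ⟨comp_CS, q2K2, fun h => A.xC (KC (K2K h)), fun w h => A.nxC w (KC (K2K h)), A.xq, A.qq2,
      fun w h => A.qC w (KC (K2K h)), fun w h => h.2.1, fun h => A.xR h.1, fun h => A.qR h.1,
      fun w h => A.nqR w h.1, ?_, ?_, ?_, by simpa using hk⟩
    · rintro w ⟨hwR, hwK2, hwB, hwν, hwx⟩ ⟨d, hd, hwd⟩
      refine ⟨ν2, rfl, ?_⟩
      by_contra hwν2
      have hwK : w ∉ K := fun h => hwK2 (comp_step hd hwd.symm ⟨h, fun h => hwν2 h.symm⟩)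
      have nxw : ¬ G.Adj x w := fun h =>
        hE w hwR h (fun h => hwB (Or.inl (Or.inl h))) d (K2K hd) hwd
      have hwC : w ∈ C := comp_step (KC (K2K hd)) hwd.symm (Or.inl ⟨hwR, nxw⟩)
      have hνw : G.Adj ν w := by
        by_contra h
        exact hwK (comp_step (K2K hd) hwd.symm ⟨hwC, h⟩)
      have hwR' : w ∈ Rp := ⟨hwR, Or.inr ⟨hwC, hνw, fun θ hθ h => hwB (Or.inr ⟨hwR, hνw, θ, hθ, h⟩)⟩⟩
      exact hE' w hwR' hνw (fun h => hwB (Or.inl (Or.inr h))) d (K2K' hd) hwd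
    · rintro θ rfl; exact ⟨xν2, nxν2⟩
    · rintro w hw h θ rfl; exact hw.2.2.2.2 h
  · set R3 := R' G ν q (insert q Ω) Θ Rp ν2 with hR3
    have s3 : ∀ w ∈ R3, ¬ G.Adj ν2 w → w ∈ K2 ∧ w ∈ R := by
      intro w hw h
      have hwK' : w ∈ K' := by
        rcases hw.2 with h1 | h1
        · exact h1
        · exact absurd h1.2.1 h
      rcases K'sub w hwK' with h2 | h2
      · exact absurd (h2 ▸ hw.1.1) A.qR
      · exact ⟨h2, hw.1.1⟩
    have ν2K : ν2 ∉ K := fun h => (KN_sub h).2 hx2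
    have e1 : insert ν2 ({w | w ∈ R1 ∧ ¬ G.Adj x w} ∪ {w | w ∈ R3 ∧ ¬ G.Adj ν2 w}) ⊆
        {w | w ∈ R ∧ ¬ G.Adj x w} := by
      rintro w (h | h | h)
      · rw [h]; exact ⟨hν2.1, nxν2⟩
      · exact ⟨h.1.1, h.2⟩
      · have := s3 w h.1 h.2
        exact ⟨this.2, A.nxC w (KC (K2K this.1))⟩
    have e2 := Set.ncard_le_ncard e1 (Set.toFinite _)
    rw [Set.ncard_insert_of_notMem ?_ (Set.toFinite _), Set.ncard_union_eq ?_ (Set.toFinite _) (Set.toFinite _)] at e2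
    · exact e2
    · rw [Set.disjoint_left]
      intro w h1 h2
      exact h1.1.2.1 (s3 w h2.1 h2.2).1
    · rintro (h | h)
      · exact h.1.2.2.2.1 rfl
      · exact ν2K (K2K (s3 ν2 h.1 h.2).1)
  · intro Z hZ
    refine ⟨Z ∪ (B ∪ ({ν2} ∪ CNx)), ⟨?_, ?_⟩, ?_⟩
    · rintro w (h | ((h | h) | h) | h | h)
      · exact (hZ.1 h).1
      · exact hER h
      · exact (hER' h).1
      · exact h.1
      · rw [h]; exact hν2.1
      · exact h.1
    · rintro n m hxn ⟨o, ho, hmo⟩ hcn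
      have hsub : (R \ (Z ∪ (B ∪ ({ν2} ∪ CNx)))) ∩ K2ᶜ ⊆ R1 \ Z := by
        intro w hw
        refine ⟨⟨hw.1.1, hw.2, fun h => hw.1.2 (Or.inr (Or.inl h)),
          fun h => hw.1.2 (Or.inr (Or.inr (Or.inl h))), fun h h' =>
            hw.1.2 (Or.inr (Or.inr (Or.inr ⟨hw.1.1, h, h'.symm⟩)))⟩, fun h => hw.1.2 (Or.inl h)⟩
      rcases hcn.exit2 (K := K2ᶜ) (fun h => A.nxC n (KC (K2K h)) hxn) with h | ⟨d, e, h1, h2, h3, h4⟩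
      · exact hZ.2 n m hxn ⟨o, ΩK2 ho, hmo⟩ (h.mono hsub)
      · exact hZ.2 n d hxn ⟨e, by simpa using h4, h2⟩ (h1.mono hsub)
    · have u1 := Set.ncard_union_le Z (B ∪ ({ν2} ∪ CNx))
      have u2 := Set.ncard_union_le B ({ν2} ∪ CNx)
      have u3 := Set.ncard_union_le {ν2} CNx
      have u4 : B.ncard ≤ (E ∪ E').ncard + De.ncard := Set.ncard_union_le (E ∪ E') De
      have u5 := Set.ncard_union_le E E'
      have u6 : De.ncard ≤ k * r0 := del_card H A2.nxΘ A.kΘ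
      have u7 : CNx.ncard ≤ {w | G.Adj x w ∧ G.Adj ν2 w}.ncard :=
        Set.ncard_le_ncard (fun w hw => hw.2) (Set.toFinite _)
      have u8 := H.cnb xν2 nxν2
      rw [Set.ncard_singleton] at u3
      have : (2 * k + 1) * r0 = k * r0 + k * r0 + r0 := by ring
      omega
end

lemma theoremA [Finite V] {r0 c1 k : ℕ} (H : Hyp G r0 c1) (hk : 1 ≤ k) (f : ℕ) :
    ∀ (x q q2 : V) (Ω Θ R : Set V), Anch G x q q2 Ω Θ R k → {w | w ∈ R ∧ ¬ G.Adj x w}.ncard = f →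
      ∃ Z, Sp G x Ω R Z ∧ Z.ncard ≤ (2 * c1 + (2 * k + 1) * r0 + 1) * Nat.log 2 (f + 1) := by
  induction f using Nat.strong_induction_on with
  | _ f ih =>
  intro x q q2 Ω Θ R A hf
  set c := 2 * c1 + (2 * k + 1) * r0 + 1 with hc
  by_cases hne : ∃ n ∈ R, G.Adj x n ∧ ∃ c ∈ CC G x q2 Ω R, G.Adj n c
  swap
  · exact ⟨∅, A.triv hne, by simp⟩
  have hc' : c = 2 * c1 + (k * r0 + k * r0 + r0) + 1 := by rw [hc]; ring
  obtain ⟨ν, hν, hx, E, hER, hEc, -, hE⟩ := A.core H hne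
  have A2 := A.step hν hx
  have hdel : (Del G Θ R ν).ncard ≤ k * r0 := del_card H A2.nxΘ A.kΘ
  by_cases hne2 : ∃ n ∈ R' G x q2 Ω Θ R ν, G.Adj ν n ∧
      ∃ c ∈ CC G ν q (insert q Ω) (R' G x q2 Ω Θ R ν), G.Adj n c
  swap
  · refine ⟨_, A.transfer hν hx hER hE (A2.triv hne2), ?_⟩
    have hf1 : 2 * 0 + 1 ≤ f := by
      obtain ⟨n, h1, h2, d, h3, h4⟩ := hne
      have : ({w | w ∈ R ∧ ¬ G.Adj x w}).ncard ≠ 0 := by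
        refine Set.ncard_ne_zero_of_mem (a := d) ?_ (Set.toFinite _)
        rcases comp_sub h3 with h | h
        · exact h
        · exact absurd h4 (A.start h1 h2 d h)
      omega
    have h1 := log_half hf1 c
    have u1 := Set.ncard_union_le (∅ ∪ E) (Del G Θ R ν)
    rw [Set.empty_union] at u1
    rw [Set.empty_union]
    omega
  obtain ⟨ν2, hν2, hx2, E', hER', hEc', -, hE'⟩ := A2.core H hne2
  have A3 := A2.step hν2 hx2
  obtain ⟨R1, Ω1, A1, hcount, htr⟩ := region1 H hk A hν hx hER hEc hE hν2 hx2 hER' hEc' hE'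
  rw [hf] at hcount
  by_cases hlt : {w | w ∈ R1 ∧ ¬ G.Adj x w}.ncard ≤
      {w | w ∈ R' G ν q (insert q Ω) Θ (R' G x q2 Ω Θ R ν) ν2 ∧ ¬ G.Adj ν2 w}.ncard
  · obtain ⟨Z, hZ, hZc⟩ := ih _ (by omega) _ _ _ _ _ _ A1 rfl
    obtain ⟨Z', hZ', hZc'⟩ := htr Z hZ
    refine ⟨Z', hZ', ?_⟩
    have := log_half (a := {w | w ∈ R1 ∧ ¬ G.Adj x w}.ncard) (f := f) (by omega) c
    omega
  · obtain ⟨Z, hZ, hZc⟩ := ih _ (by omega) _ _ _ _ _ _ A3 rfl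
    refine ⟨_, A.transfer hν hx hER hE (A2.transfer hν2 hx2 hER' hE' hZ), ?_⟩
    have h0 := log_half (a := {w | w ∈ R' G ν q (insert q Ω) Θ (R' G x q2 Ω Θ R ν) ν2 ∧ ¬ G.Adj ν2 w}.ncard) (f := f) (by omega) c
    have hdel' : (Del G Θ (R' G x q2 Ω Θ R ν) ν2).ncard ≤ k * r0 := del_card H A3.nxΘ A.kΘ
    have u1 := Set.ncard_union_le (Z ∪ E' ∪ Del G Θ (R' G x q2 Ω Θ R ν) ν2 ∪ E) (Del G Θ R ν)
    have u2 := Set.ncard_union_le (Z ∪ E' ∪ Del G Θ (R' G x q2 Ω Θ R ν) ν2) E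
    have u3 := Set.ncard_union_le (Z ∪ E') (Del G Θ (R' G x q2 Ω Θ R ν) ν2)
    have u4 := Set.ncard_union_le Z E'
    omega

lemma ncard_bU [Finite V] (S : Set V) (F : V → Set V) (M : ℕ) (h : ∀ s ∈ S, (F s).ncard ≤ M) :
    (⋃ s ∈ S, F s).ncard ≤ S.ncard * M := by
  have hfin := Set.toFinite S
  have e : (⋃ s ∈ S, F s) = ⋃ s ∈ hfin.toFinset, F s := by simp
  rw [e]
  refine (Finset.set_ncard_biUnion_le hfin.toFinset F).trans ?_
  refine (Finset.sum_le_sum (g := fun _ => M) fun s hs => h s (by simpa using hs)).trans ?_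
  rw [Finset.sum_const, ← Set.ncard_eq_toFinset_card S hfin, smul_eq_mul]

def DD (G : SimpleGraph V) (v : V) (S : Set V) : Set V :=
  comp G {w | w ∉ S ∧ ∀ z ∈ S, ¬ G.Adj z w} v

structure Fam (G : SimpleGraph V) (u v : V) (s2 : ℕ) (S : Set V) : Prop where
  cs : CS G S
  card : S.ncard ≤ s2
  vS : v ∉ S
  nvS : ∀ z ∈ S, ¬ G.Adj z v
  uD : u ∉ DD G v S
  nuD : ∀ w ∈ DD G v S, ¬ G.Adj u w

lemma DD_sub {v w : V} {S : Set V} (h : w ∈ DD G v S) : w ∉ S ∧ ∀ z ∈ S, ¬ G.Adj z w := by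
  have := comp_sub h
  exact this

lemma Fam.vD {u v : V} {s2 : ℕ} {S : Set V} (F : Fam G u v s2 S) : v ∈ DD G v S :=
  mem_comp_self ⟨F.vS, F.nvS⟩

/-- boundary vertices attach to S -/
lemma DD_bd {v : V} {S : Set V} {a d : V} (hd : d ∈ DD G v S) (had : G.Adj a d)
    (ha : a ∉ DD G v S) : a ∉ S ∧ ∃ z ∈ S, G.Adj z a := by
  have h1 : a ∉ S := fun h => (DD_sub hd).2 a h had
  refine ⟨h1, ?_⟩
  by_contra h
  push Not at h
  exact ha (comp_step hd had.symm ⟨h1, h⟩)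

lemma Zb [Finite V] {r0 c1 : ℕ} (H : Hyp G r0 c1) {u v : V} {S : Set V}
    (F : Fam G u v (1 + r0 + r0 * r0) S)
    (hmin : ∀ S', Fam G u v (1 + r0 + r0 * r0) S' → (DD G v S).ncard ≤ (DD G v S').ncard)
    {b d0 : V} (hb : b ∉ DD G v S) (hd0 : d0 ∈ DD G v S) (hbd0 : G.Adj b d0) (hbv : ¬ G.Adj b v) :
    ∃ Z ⊆ DD G v S, v ∉ Z ∧
      Z.ncard ≤ (2 * c1 + (2 * (r0 * r0 + 1) + 1) * r0 + 1) * Nat.log 2 (Nat.card V) +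
        (1 + r0) * r0 + (r0 * r0 + 1) * r0 ∧
      ∀ c, G.Adj b c → ¬ Cn G (DD G v S \ Z) c v := by
  classical
  set D := DD G v S with hD
  have vD : v ∈ D := F.vD
  have hbv' : b ≠ v := fun h => hb (h ▸ vD)
  set D0 := comp G {w | w ∈ D ∧ ¬ G.Adj b w} v with hD0
  have vD0 : v ∈ D0 := mem_comp_self ⟨vD, hbv⟩
  have D0s : ∀ w ∈ D0, w ∈ D ∧ ¬ G.Adj b w := fun w hw => by
    have := comp_sub hw
    exact this
  obtain ⟨N, hNA, hNc, hN⟩ := JM H (ν := b) (D := D0) (A := {c | c ∈ D ∧ G.Adj b c ∧ ¬ G.Adj c v}) vD0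
    (fun h => hb (D0s b h).1) (fun w hw => (D0s w hw).2) (fun a ha => ha.2)
  set D1 := comp G {w | w ∈ D0 ∧ ∀ n ∈ N, ¬ G.Adj n w} v with hD1
  have D1s : ∀ w ∈ D1, w ∈ D0 ∧ ∀ n ∈ N, ¬ G.Adj n w := fun w hw => by
    have := comp_sub hw
    exact this
  have vD1 : v ∈ D1 := mem_comp_self ⟨vD0, fun n hn => (hNA hn).2.2⟩
  have hM : ∀ n, ∃ M : Set V, n ∈ N → (M ⊆ {e | e ∈ D ∧ G.Adj n e ∧ ¬ G.Adj b e ∧ ¬ G.Adj e v} ∧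
      M.ncard ≤ r0 ∧ ∀ a ∈ {e | e ∈ D ∧ G.Adj n e ∧ ¬ G.Adj b e ∧ ¬ G.Adj e v},
        ∀ w ∈ comp G {w | w ∈ D1 ∧ ∀ m ∈ M, ¬ G.Adj m w} v, ¬ G.Adj a w) := by
    intro n
    by_cases hn : n ∈ N
    · obtain ⟨M, h⟩ := JM H (ν := n) (D := D1)
        (A := {e | e ∈ D ∧ G.Adj n e ∧ ¬ G.Adj b e ∧ ¬ G.Adj e v}) vD1
        (fun h => (D0s n (D1s n h).1).2 (hNA hn).2.1) (fun w hw => (D1s w hw).2 n hn)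
        (fun a ha => ⟨ha.2.1, ha.2.2.2⟩)
      exact ⟨M, fun _ => h⟩
    · exact ⟨∅, fun h => absurd h hn⟩
  choose M hM using hM
  set Θ0 : Set V := ⋃ n ∈ N, M n with hΘ0
  have Θ0m : ∀ θ, θ ∈ Θ0 ↔ ∃ n ∈ N, θ ∈ M n := fun θ => by simp [hΘ0]
  have Θ0p : ∀ θ ∈ Θ0, θ ∈ D ∧ ¬ G.Adj b θ ∧ ¬ G.Adj θ v ∧ ∃ n ∈ N, G.Adj n θ := by
    intro θ hθ
    obtain ⟨n, hn, h⟩ := (Θ0m θ).1 hθ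
    have := (hM n hn).1 h
    exact ⟨this.1, this.2.2.1, this.2.2.2, n, hn, this.2.1⟩
  have Θ0v : v ∉ Θ0 := fun h => by
    obtain ⟨-, -, -, n, hn, h'⟩ := Θ0p v h
    exact (hNA hn).2.2 h'
  have Θ0c : Θ0.ncard ≤ r0 * r0 :=
    (ncard_bU N M r0 fun n hn => (hM n hn).2.1).trans (Nat.mul_le_mul_right _ hNc)
  set D2 := comp G {w | w ∈ D1 ∧ ∀ θ ∈ Θ0, ¬ G.Adj θ w} v with hD2
  have D2s : ∀ w ∈ D2, w ∈ D1 ∧ ∀ θ ∈ Θ0, ¬ G.Adj θ w := fun w hw => by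
    have := comp_sub hw
    exact this
  have D2D : ∀ w ∈ D2, w ∈ D := fun w hw => (D0s w (D1s w (D2s w hw).1).1).1
  have D2b : ∀ w ∈ D2, ¬ G.Adj b w := fun w hw => (D0s w (D1s w (D2s w hw).1).1).2
  have vD2 : v ∈ D2 := mem_comp_self ⟨vD1, fun θ hθ => (Θ0p θ hθ).2.2.1⟩
  -- attachments
  have att : ∀ w ∈ D, w ∉ D2 → (∃ d ∈ D2, G.Adj w d) →
      ¬ (G.Adj v w ∧ ∃ θ ∈ insert b N, G.Adj w θ) → ∃ θ ∈ Θ0, G.Adj w θ := by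
    rintro w hwD hwD2 ⟨d, hd, hwd⟩ hno
    by_contra hcon
    push Not at hcon
    have hw1 : w ∉ D1 := fun h => hwD2 (comp_step hd hwd.symm ⟨h, fun θ hθ h => hcon θ hθ h.symm⟩)
    have hd1 := (D2s d hd).1
    by_cases hwb : G.Adj b w
    · by_cases hwv : G.Adj w v
      · exact hno ⟨hwv.symm, b, Or.inl rfl, hwb.symm⟩
      · exact hN w ⟨hwD, hwb, hwv⟩ d hd1 hwd
    · have hw0 : w ∈ D0 := comp_step (D1s d hd1).1 hwd.symm ⟨hwD, hwb⟩
      have : ∃ n ∈ N, G.Adj n w := by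
        by_contra h
        push Not at h
        exact hw1 (comp_step hd1 hwd.symm ⟨hw0, h⟩)
      obtain ⟨n, hn, hnw⟩ := this
      by_cases hwv : G.Adj w v
      · exact hno ⟨hwv.symm, n, Or.inr hn, hnw.symm⟩
      · refine (hM n hn).2.2 w ⟨hwD, hnw, hwb, hwv⟩ d ?_ hwd
        exact Cn.mono hd fun z hz => ⟨hz.1, fun m hm => hz.2 m ((Θ0m m).2 ⟨n, hn, hm⟩)⟩
  -- the escape vertex
  set S2 : Set V := insert b (N ∪ Θ0) with hS2
  have hm : ∃ m d, m ∉ D2 ∧ d ∈ D2 ∧ G.Adj m d ∧ m ∉ S2 ∧ ∀ z ∈ S2, ¬ G.Adj z m := by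
    by_contra hcon
    push Not at hcon
    have vS2 : v ∉ S2 := by
      rintro (h | h | h)
      · exact hbv' h.symm
      · exact hbv (hNA h).2.1
      · exact Θ0v h
    have hsub : DD G v S2 ⊆ D2 := by
      intro w hw
      refine Cn.closed hw vD2 ?_
      intro d hd e he hde
      by_contra h
      obtain ⟨z, hz, hz'⟩ := hcon e d h hd hde.symm he.1
      exact he.2 z hz hz'
    have hF : Fam G u v (1 + r0 + r0 * r0) S2 := by
      refine ⟨?_, ?_, vS2, ?_, fun h => F.uD (D2D _ (hsub h)), fun w h => F.nuD w (D2D _ (hsub h))⟩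
      · apply CS_of_center (a := b)
        have hbb : Cn G S2 b b := Cn.refl (Or.inl rfl)
        have hNN : ∀ n ∈ N, Cn G S2 b n := fun n hn => hbb.step (hNA hn).2.1 (Or.inr (Or.inl hn))
        rintro w (h | h | h)
        · rw [h]; exact hbb
        · exact hNN w h
        · obtain ⟨-, -, -, n, hn, h'⟩ := Θ0p w h
          exact (hNN n hn).step h' (Or.inr (Or.inr h))
      · have h1 : S2.ncard ≤ (N ∪ Θ0).ncard + 1 := Set.ncard_insert_le b (N ∪ Θ0)
        have h2 := Set.ncard_union_le N Θ0
        omega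
      · rintro z (h | h | h)
        · rw [h]; exact hbv
        · exact (hNA h).2.2
        · exact (Θ0p z h).2.2.1
    have h1 := hmin S2 hF
    have h2 := Set.ncard_le_ncard hsub (Set.toFinite _)
    have h3 := Set.eq_of_subset_of_ncard_le (s := D2) (t := D) D2D (by omega) (Set.toFinite _)
    exact D2b d0 (by rw [h3]; exact hd0) hbd0
  obtain ⟨m, dm, hmD2, hdm, hmdm, hmS2, hmS2'⟩ := hm
  have hbm : b ≠ m := fun h => hmS2 (Or.inl h.symm)
  have nbm : ¬ G.Adj b m := hmS2' b (Or.inl rfl)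
  have hmD : m ∉ D := by
    intro h
    apply hmD2
    have h0 : m ∈ D0 := comp_step (D1s _ (D2s _ hdm).1).1 hmdm.symm ⟨h, nbm⟩
    have h1 : m ∈ D1 := comp_step (D2s _ hdm).1 hmdm.symm ⟨h0, fun n hn => hmS2' n (Or.inr (Or.inl hn))⟩
    exact comp_step hdm hmdm.symm ⟨h1, fun n hn => hmS2' n (Or.inr (Or.inr hn))⟩
  obtain ⟨hmS, z, hzS, hzm⟩ := DD_bd (D2D _ hdm) hmdm hmD
  obtain ⟨hbS, z', hzS', hzb⟩ := DD_bd hd0 hbd0 hb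
  -- path through S
  have hcs : CS G (insert m (insert b S)) := (F.cs.ins hzS' hzb.symm).ins (Or.inr hzS) hzm.symm
  obtain ⟨L, g, hg, g0, gL, gS⟩ := exists_indP (hcs b (Or.inr (Or.inl rfl)) m (Or.inl rfl))
  have hL : 2 ≤ L := by
    by_contra h
    rcases (show L = 0 ∨ L = 1 by omega) with h | h
    · subst h; exact hbm (g0.symm.trans gL)
    · subst h
      apply nbm
      rw [← g0, ← gL]
      exact (hg.2 0 1 (by omega) le_rfl).2 rfl
  have gS' : ∀ i, 1 ≤ i → i < L → g i ∈ S := by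
    intro i h1 h2
    rcases gS i h2.le with h | h | h
    · have := hg.1 i h2.le L le_rfl (by rw [h, gL]); omega
    · have := hg.1 i h2.le 0 (by omega) (by rw [h, g0]); omega
    · exact h
  have SD : ∀ z ∈ S, z ∉ D ∧ ∀ w ∈ D, ¬ G.Adj z w := fun z hz =>
    ⟨fun h => (DD_sub h).1 hz, fun w hw => (DD_sub hw).2 z hz⟩
  have g1S := gS' 1 le_rfl (by omega)
  set P : Set V := {w | ∃ i, 2 ≤ i ∧ i ≤ L ∧ w = g i} with hP
  have Pcs : CS G P := by
    apply CS_of_center (a := g 2)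
    have : ∀ i, 2 + i ≤ L → Cn G P (g 2) (g (2 + i)) := by
      intro i
      induction i with
      | zero => intro h; exact Cn.refl ⟨2, le_rfl, h, rfl⟩
      | succ i ih =>
        intro h
        exact (ih (by omega)).step ((hg.2 (2 + i) (2 + (i + 1)) (by omega) h).2 (by omega))
          ⟨2 + (i + 1), by omega, h, rfl⟩
    rintro w ⟨i, h1, h2, rfl⟩
    have := this (i - 2) (by omega)
    rwa [show 2 + (i - 2) = i by omega] at this
  have PD : ∀ w ∈ P, w ∉ D := by
    rintro w ⟨i, h1, h2, rfl⟩
    rcases h2.eq_or_lt with h | h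
    · rw [h, gL]; exact hmD
    · exact (SD _ (gS' i (by omega) h)).1
  set Θ : Set V := insert m Θ0 with hΘ
  set T1 := Del G (insert b N) D v with hT1
  set T2 := Del G Θ D b with hT2
  set R : Set V := {w | w ∈ D ∧ w ∉ D2 ∧ w ∉ T1 ∧ w ∉ T2} with hR
  have nbΘ : ∀ θ ∈ Θ, b ≠ θ ∧ ¬ G.Adj b θ := by
    rintro θ (h | h)
    · rw [h]; exact ⟨hbm, nbm⟩
    · exact ⟨fun h' => hb (h' ▸ (Θ0p θ h).1), (Θ0p θ h).2.1⟩
  have Θc : Θ.ncard ≤ r0 * r0 + 1 := by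
    have : Θ.ncard ≤ Θ0.ncard + 1 := Set.ncard_insert_le m Θ0
    omega
  have A : Anch G b (g 1) (g 2) (P ∪ D2) Θ R (r0 * r0 + 1) := by
    refine ⟨?_, ?_, ?_, ?_, ?_, ?_, ?_, ?_, ?_, ?_, ?_, ?_, nbΘ, ?_, Θc⟩
    · exact Pcs.union comp_CS (a := m) (b := dm) ⟨L, hL, le_rfl, gL.symm⟩ hdm hmdm
    · exact Or.inl ⟨2, le_rfl, hL, rfl⟩
    · rintro (⟨i, h1, h2, h⟩ | h)
      · have := hg.1 0 (by omega) i h2 (by rw [g0, h]); omega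
      · exact hb (D2D _ h)
    · rintro w (⟨i, h1, h2, rfl⟩ | h) h'
      · have := (hg.2 0 i (by omega) h2).1 (by rw [g0]; exact h'); omega
      · exact D2b w h h'
    · rw [← g0]; exact (hg.2 0 1 (by omega) (by omega)).2 rfl
    · exact (hg.2 1 2 (by omega) (by omega)).2 rfl
    · rintro w (⟨i, h1, h2, rfl⟩ | h) h'
      · have := (hg.2 1 i (by omega) h2).1 h'
        rw [this]
      · exact absurd h' ((SD _ g1S).2 w (D2D w h))
    · rintro w hw (h | h)
      · exact PD w h hw.1
      · exact hw.2.1 h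
    · exact fun h => hb h.1
    · exact fun h => (SD _ g1S).1 h.1
    · exact fun w hw => (SD _ g1S).2 w hw.1
    · rintro w hw ⟨o, (⟨i, h1, h2, rfl⟩ | h), h'⟩
      · rcases h2.eq_or_lt with h | h
        · subst h; exact ⟨m, Or.inl rfl, gL ▸ h'⟩
        · exact absurd h'.symm ((SD _ (gS' i (by omega) h)).2 w hw.1)
      · obtain ⟨θ, h1, h2⟩ := att w hw.1 hw.2.1 ⟨o, h, h'⟩ (fun h => hw.2.2.1 ⟨hw.1, h⟩)
        exact ⟨θ, Or.inr h1, h2⟩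
    · intro w hw hbw θ hθ h
      exact hw.2.2.2 ⟨hw.1, hbw, θ, hθ, h⟩
  obtain ⟨Z, hZ, hZc⟩ := theoremA H (by omega) _ _ _ _ _ _ _ A rfl
  refine ⟨Z ∪ (T1 ∪ T2), ?_, ?_, ?_, ?_⟩
  · rintro w (h | h | h)
    · exact (hZ.1 h).1
    · exact h.1
    · exact h.1
  · rintro (h | h | h)
    · exact (hZ.1 h).2.1 vD2
    · exact G.loopless.irrefl _ h.2.1
    · exact hbv h.2.1
  · have u1 := Set.ncard_union_le Z (T1 ∪ T2)
    have u2 := Set.ncard_union_le T1 T2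
    have u3 : T2.ncard ≤ (r0 * r0 + 1) * r0 := del_card H nbΘ Θc
    have u4 : T1.ncard ≤ (1 + r0) * r0 := by
      refine del_card H ?_ ?_
      · rintro θ (h | h)
        · rw [h]; exact ⟨hbv'.symm, fun h => hbv h.symm⟩
        · exact ⟨fun h' => hbv (by rw [h']; exact (hNA h).2.1), fun h' => (hNA h).2.2 h'.symm⟩
      · have := Set.ncard_insert_le b N
        omega
    have u5 : {w | w ∈ R ∧ ¬ G.Adj b w}.ncard + 1 ≤ Nat.card V := by
      rw [← Set.ncard_univ, ← Set.ncard_insert_of_notMem (a := u) ?_ (Set.toFinite _)]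
      · exact Set.ncard_le_ncard (Set.subset_univ _) (Set.toFinite _)
      · exact fun h => F.uD h.1.1
    have u6 := Nat.mul_le_mul_left (2 * c1 + (2 * (r0 * r0 + 1) + 1) * r0 + 1)
      (Nat.log_mono_right (b := 2) u5)
    omega
  · intro c hbc hcn
    obtain ⟨d, e, h1, h2, h3, h4⟩ := hcn.exit (K := D2ᶜ) (fun h => D2b c h hbc) (fun h => h vD2)
    refine hZ.2 c d hbc ⟨e, Or.inr (by simpa using h4), h2⟩ (h1.mono ?_)
    intro w hw
    exact ⟨⟨hw.1.1, hw.2, fun h => hw.1.2 (Or.inr (Or.inl h)), fun h => hw.1.2 (Or.inr (Or.inr h))⟩,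
      fun h => hw.1.2 (Or.inl h)⟩

lemma final [Finite V] {r0 c1 : ℕ} (H : Hyp G r0 c1) {u v : V} (huv : u ≠ v) (nuv : ¬ G.Adj u v) :
    ∃ X : Set V, u ∉ X ∧ v ∉ X ∧
      X.ncard ≤ ((1 + r0 + r0 * r0) * r0) *
        ((2 * c1 + (2 * (r0 * r0 + 1) + 1) * r0 + 1) * Nat.log 2 (Nat.card V) +
        (1 + r0) * r0 + (r0 * r0 + 1) * r0) + (1 + r0 + r0 * r0) * r0 ∧
      ¬ Cn G Xᶜ u v := by
  have hu : Fam G u v (1 + r0 + r0 * r0) {u} := by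
    refine ⟨?_, by simp; omega, fun h => huv h.symm, ?_, fun h => (DD_sub h).1 rfl,
      fun w h => (DD_sub h).2 u rfl⟩
    · rintro a rfl b rfl; exact Cn.refl rfl
    · rintro z rfl; exact nuv
  obtain ⟨S, F, hmin⟩ := Set.exists_min_image {S : Set V | Fam G u v (1 + r0 + r0 * r0) S}
    (fun S => (DD G v S).ncard) (Set.toFinite _) ⟨_, hu⟩
  have F : Fam G u v (1 + r0 + r0 * r0) S := F
  set D := DD G v S with hD
  have vD : v ∈ D := F.vD
  have hM : ∀ ν, ∃ M : Set V, ν ∈ S → (M ⊆ {a | a ∉ D ∧ G.Adj ν a ∧ (∃ d ∈ D, G.Adj a d) ∧ ¬ G.Adj a v} ∧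
      M.ncard ≤ r0 ∧ ∀ a ∈ {a | a ∉ D ∧ G.Adj ν a ∧ (∃ d ∈ D, G.Adj a d) ∧ ¬ G.Adj a v},
        ∀ w ∈ comp G {w | w ∈ D ∧ ∀ m ∈ M, ¬ G.Adj m w} v, ¬ G.Adj a w) := by
    intro ν
    by_cases hn : ν ∈ S
    · obtain ⟨M, h⟩ := JM H (ν := ν) (D := D)
        (A := {a | a ∉ D ∧ G.Adj ν a ∧ (∃ d ∈ D, G.Adj a d) ∧ ¬ G.Adj a v}) vD
        (fun h => (DD_sub h).1 hn) (fun w hw => (DD_sub hw).2 ν hn)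
        (fun a ha => ⟨ha.2.1, ha.2.2.2⟩)
      exact ⟨M, fun _ => h⟩
    · exact ⟨∅, fun h => absurd h hn⟩
  choose M hM using hM
  set B : Set V := ⋃ ν ∈ S, M ν with hB
  have Bm : ∀ b, b ∈ B ↔ ∃ ν ∈ S, b ∈ M ν := fun b => by simp [hB]
  have Bc : B.ncard ≤ (1 + r0 + r0 * r0) * r0 :=
    (ncard_bU S M r0 fun n hn => (hM n hn).2.1).trans (Nat.mul_le_mul_right _ F.card)
  have hZ : ∀ b, ∃ Z : Set V, b ∈ B → (Z ⊆ D ∧ v ∉ Z ∧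
      Z.ncard ≤ (2 * c1 + (2 * (r0 * r0 + 1) + 1) * r0 + 1) * Nat.log 2 (Nat.card V) +
        (1 + r0) * r0 + (r0 * r0 + 1) * r0 ∧
      ∀ c, G.Adj b c → ¬ Cn G (D \ Z) c v) := by
    intro b
    by_cases hb : b ∈ B
    · obtain ⟨ν, hν, hbM⟩ := (Bm b).1 hb
      obtain ⟨h1, h2, ⟨d, h3, h4⟩, h5⟩ := (hM ν hν).1 hbM
      obtain ⟨Z, h⟩ := Zb H F hmin h1 h3 h4 h5
      exact ⟨Z, fun _ => h⟩
    · exact ⟨∅, fun h => absurd h hb⟩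
  choose Z hZ using hZ
  set T : Set V := {a | a ∉ D ∧ (∃ d ∈ D, G.Adj a d) ∧ G.Adj a v} with hT
  have Zm : ∀ w, w ∈ (⋃ b ∈ B, Z b) ↔ ∃ b ∈ B, w ∈ Z b := fun w => by simp
  refine ⟨(⋃ b ∈ B, Z b) ∪ T, ?_, ?_, ?_, ?_⟩
  · rintro (h | h)
    · obtain ⟨b, hb, h⟩ := (Zm _).1 h
      exact F.uD ((hZ b hb).1 h)
    · obtain ⟨-, ⟨d, hd, h⟩, -⟩ := h
      exact F.nuD d hd h
  · rintro (h | h)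
    · obtain ⟨b, hb, h⟩ := (Zm _).1 h
      exact (hZ b hb).2.1 h
    · exact h.1 vD
  · have u1 := Set.ncard_union_le (⋃ b ∈ B, Z b) T
    have u2 := ncard_bU B Z _ fun b hb => (hZ b hb).2.2.1
    have u3 := Nat.mul_le_mul_right ((2 * c1 + (2 * (r0 * r0 + 1) + 1) * r0 + 1) * Nat.log 2 (Nat.card V) +
        (1 + r0) * r0 + (r0 * r0 + 1) * r0) Bc
    have u4 : T ⊆ Del G S Set.univ v := by
      rintro a ⟨h1, ⟨d, hd, h2⟩, h3⟩
      obtain ⟨-, z, hz, h4⟩ := DD_bd hd h2 h1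
      exact ⟨trivial, h3.symm, z, hz, h4.symm⟩
    have u5 := Set.ncard_le_ncard u4 (Set.toFinite _)
    have u6 : (Del G S Set.univ v).ncard ≤ (1 + r0 + r0 * r0) * r0 :=
      del_card H (fun z hz => ⟨fun h => F.vS (h ▸ hz), fun h => F.nvS z hz h.symm⟩) F.card
    omega
  · intro hcn
    obtain ⟨d, a, h1, h2, h3, h4⟩ := hcn.symm.exit (K := D) vD F.uD
    have hdD := h1.right.2
    have nav : ¬ G.Adj a v := fun h => h3 (Or.inr ⟨h4, ⟨d, hdD, h2.symm⟩, h⟩)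
    obtain ⟨-, ν, hν, hνa⟩ := DD_bd hdD h2.symm h4
    have hd' : d ∉ comp G {w | w ∈ D ∧ ∀ m ∈ M ν, ¬ G.Adj m w} v := fun h =>
      (hM ν hν).2.2 a ⟨h4, hνa, ⟨d, hdD, h2.symm⟩, nav⟩ d h h2.symm
    have hv' : v ∈ comp G {w | w ∈ D ∧ ∀ m ∈ M ν, ¬ G.Adj m w} v :=
      mem_comp_self ⟨vD, fun m hm => ((hM ν hν).1 hm).2.2.2⟩
    obtain ⟨d', e, k1, k2, k3, k4⟩ := h1.exit hv' hd'
    have : ∃ b ∈ M ν, G.Adj b e := by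
      by_contra h
      push Not at h
      exact k4 (comp_step k1.right.2 k2 ⟨k3.2, h⟩)
    obtain ⟨b, hb, hbe⟩ := this
    have hbB : b ∈ B := (Bm b).2 ⟨ν, hν, hb⟩
    have hno : ∀ w, w ∈ ((⋃ b ∈ B, Z b) ∪ T)ᶜ → w ∉ Z b := fun w hw h =>
      hw (Or.inl ((Zm w).2 ⟨b, hbB, h⟩))
    refine (hZ b hbB).2.2.2 e hbe (Cn.symm ((k1.mono ?_).step k2 ⟨k3.2, hno e k3.1⟩))
    exact fun w hw => ⟨hw.1.2, hno w hw.1.1⟩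

lemma main (t : ℕ) (ht : 2 ≤ t) :
    ∃ c : ℕ, ∀ (V : Type) [Fintype V] (G : SimpleGraph V),
      G.CliqueFree t → Paper.ThetaFree G → Paper.PyramidFree G →
      ∀ u v : V, u ≠ v → ¬ G.Adj u v →
        ∃ X : Finset V, u ∉ X ∧ v ∉ X ∧
          (X.card : ℝ) ≤ (t : ℝ) ^ c * Real.logb 2 (Fintype.card V) ∧
          ∀ Wk : G.Walk u v, ∃ x ∈ Wk.support, x ∈ X := by
  obtain ⟨N3, hN3⟩ := ramsey 3 t
  set r0 := N3 + 2 with hr0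
  obtain ⟨c1, hc1⟩ := ramsey r0 t
  set P := (1 + r0 + r0 * r0) * r0 with hP
  set c := 2 * c1 + (2 * (r0 * r0 + 1) + 1) * r0 + 1 with hc
  set Q := (1 + r0) * r0 + (r0 * r0 + 1) * r0 with hQ
  refine ⟨P * (c + Q) + P, fun V _ G hcl hth hpy u v huv nuv => ?_⟩
  classical
  have H : Hyp G r0 c1 := ⟨hth, hpy, by omega, fun A hA => hN3 V G hcl A (by omega), hc1 V G hcl⟩
  obtain ⟨X, hu, hv, hcard, hsep⟩ := final H huv nuv
  refine ⟨X.toFinset, by simpa using hu, by simpa using hv, ?_, ?_⟩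
  · rw [← Set.ncard_eq_toFinset_card']
    rw [Nat.card_eq_fintype_card] at hcard
    have hn : 2 ≤ Fintype.card V := by
      have := Fintype.one_lt_card_iff.2 ⟨u, v, huv⟩
      omega
    set n := Fintype.card V with hn'
    have hl1 : 1 ≤ Nat.log 2 n := Nat.log_pos (by norm_num) hn
    have h1 : X.ncard ≤ (P * (c + Q) + P) * Nat.log 2 n := by
      have hcard2 := hcard
      rw [add_assoc (_ * Nat.log 2 n), ← hQ] at hcard2
      refine hcard2.trans ?_
      have : Q ≤ Q * Nat.log 2 n := Nat.le_mul_of_pos_right _ hl1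
      have h3 : P ≤ P * Nat.log 2 n := Nat.le_mul_of_pos_right _ hl1
      have h2 : P * (c * Nat.log 2 n + Q) ≤ P * (c * Nat.log 2 n + Q * Nat.log 2 n) :=
        Nat.mul_le_mul_left _ (by omega)
      calc P * (c * Nat.log 2 n + Q) + P ≤ P * (c * Nat.log 2 n + Q * Nat.log 2 n) + P * Nat.log 2 n := by omega
        _ = _ := by ring
    have h2 : (P * (c + Q) + P) ≤ t ^ (P * (c + Q) + P) :=
      (Nat.lt_pow_self (by omega)).le
    have h3 : (Nat.log 2 n : ℝ) ≤ Real.logb 2 n := by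
      have := Real.natLog_le_logb n 2
      exact_mod_cast this
    calc (X.ncard : ℝ) ≤ ((P * (c + Q) + P : ℕ) : ℝ) * (Nat.log 2 n : ℝ) := by exact_mod_cast h1
      _ ≤ ((t ^ (P * (c + Q) + P) : ℕ) : ℝ) * Real.logb 2 n := by
        apply mul_le_mul _ h3 (by positivity) (by positivity)
        exact_mod_cast h2
      _ = _ := by push_cast; rfl
  · intro Wk
    by_contra hcon
    push Not at hcon
    exact hsep (Cn.of_walk Wk fun w hw h => hcon w hw (by simpa using h))

end Sep




/-- Every `n`-vertex (`K_t`, theta, pyramid)-free graph is `t^c · log n`-pairwise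
separable. -/
theorem pairwise_separable (t : ℕ) (ht : 2 ≤ t) :
    ∃ c : ℕ, ∀ (V : Type) [Fintype V] (G : SimpleGraph V),
      G.CliqueFree t → Paper.ThetaFree G → Paper.PyramidFree G →
      ∀ u v : V, u ≠ v → ¬ G.Adj u v →
        ∃ X : Finset V, u ∉ X ∧ v ∉ X ∧
          (X.card : ℝ) ≤ (t : ℝ) ^ c * Real.logb 2 (Fintype.card V) ∧
          ∀ Wk : G.Walk u v, ∃ x ∈ Wk.support, x ∈ X := by
  exact Sep.main t ht
end

section
/- Let G be a graph such that for every weight function w: V(G) → [0,1] with total weight at most 1, there exists a set X ⊆ V(G) with |X| ≤ d such that every connected component D of G \ X satisfies w(D) ≤ 1/2. Then the treewidth of G is at most 2d. -/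
open SimpleGraph

namespace Paper

/-- `G` has a tree decomposition of width at most `k`. -/
def HasTreeDecompWidth {V : Type} (G : SimpleGraph V) (k : ℕ) : Prop :=
  ∃ (ι : Type) (T : SimpleGraph ι) (χ : ι → Finset V),
    T.IsTree ∧
    (∀ v : V, ∃ i, v ∈ χ i) ∧
    (∀ u v : V, G.Adj u v → ∃ i, u ∈ χ i ∧ v ∈ χ i) ∧
    (∀ v : V, (T.induce {i | v ∈ χ i}).Connected) ∧
    (∀ i, (χ i).card ≤ k + 1)

end Paper


namespace TWB

open Classical in
/-- Rooted tree decompositions of `G[U]` with root bag `R`, all bags satisfying `P`. -/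
inductive TD {V : Type} (G : SimpleGraph V) (P : Finset V → Prop) : Finset V → Finset V → Prop
  | leaf (R : Finset V) (h : P R) : TD G P R R
  | join (U₁ R₁ U₂ R₂ : Finset V) (h₁ : TD G P U₁ R₁) (h₂ : TD G P U₂ R₂)
      (hi : ∀ v, v ∈ U₁ → v ∈ U₂ → v ∈ R₁ ∧ v ∈ R₂)
      (he : ∀ a b, a ∈ U₁ → a ∉ U₂ → b ∈ U₂ → b ∉ U₁ → ¬ G.Adj a b) : TD G P (U₁ ∪ U₂) R₁

section
open Classical
variable {V : Type} {G : SimpleGraph V} {P Q : Finset V → Prop}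

lemma TD.prop {U R : Finset V} (h : TD G P U R) : P R := by
  induction h with
  | leaf R h => exact h
  | join _ _ _ _ _ _ _ _ ih _ => exact ih

lemma TD.sub {U R : Finset V} (h : TD G P U R) : R ⊆ U := by
  induction h with
  | leaf R h => exact Finset.Subset.refl _
  | join _ _ _ _ _ _ _ _ ih _ => exact ih.trans Finset.subset_union_left

lemma TD.join' {U₁ R₁ U₂ R₂ U : Finset V} (h₁ : TD G P U₁ R₁) (h₂ : TD G P U₂ R₂)
      (hi : ∀ v, v ∈ U₁ → v ∈ U₂ → v ∈ R₁ ∧ v ∈ R₂)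
      (he : ∀ a b, a ∈ U₁ → a ∉ U₂ → b ∈ U₂ → b ∉ U₁ → ¬ G.Adj a b)
      (hU : ∀ v, v ∈ U ↔ v ∈ U₁ ∨ v ∈ U₂) : TD G P U R₁ := by
  have : U = U₁ ∪ U₂ := by ext v; simp [hU]
  rw [this]; exact TD.join _ _ _ _ h₁ h₂ hi he

lemma TD.reroot {U R : Finset V} (h : TD G P U R) : TD G Q U R ∨ ∃ S, P S ∧ ¬ Q S ∧
    ∀ U' R', TD G P U' R' → (∀ v, v ∈ U → v ∈ U' → v ∈ R ∧ v ∈ R') →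
      (∀ a b, a ∈ U → a ∉ U' → b ∈ U' → b ∉ U → ¬ G.Adj a b) → TD G P (U ∪ U') S := by
  induction h with
  | leaf R h =>
    by_cases hq : Q R
    · exact Or.inl (TD.leaf R hq)
    · exact Or.inr ⟨R, h, hq, fun U' R' h' hi he => TD.join _ _ _ _ (TD.leaf R h) h' hi he⟩
  | join U₁ R₁ U₂ R₂ h₁ h₂ hi he ih₁ ih₂ =>
    have s₁ := h₁.sub
    have s₂ := h₂.sub
    rcases ih₁ with q₁ | ⟨S, pS, qS, hS⟩
    · rcases ih₂ with q₂ | ⟨S, pS, qS, hS⟩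
      · exact Or.inl (TD.join _ _ _ _ q₁ q₂ hi he)
      · refine Or.inr ⟨S, pS, qS, fun U' R' h' hi' he' => ?_⟩
        have s' := h'.sub
        have k := hS (U₁ ∪ U') R₁ (TD.join _ _ _ _ h₁ h' (by grind) (by grind)) (by grind)
          (by have := fun a b => G.adj_comm a b
              grind)
        have e : U₁ ∪ U₂ ∪ U' = U₂ ∪ (U₁ ∪ U') := by grind
        rw [e]; exact k
    · refine Or.inr ⟨S, pS, qS, fun U' R' h' hi' he' => ?_⟩
      have s' := h'.sub
      have j1 : TD G P (R₁ ∪ U₂) R₁ := TD.join _ _ _ _ (TD.leaf R₁ h₁.prop) h₂ (by grind) (by grind)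
      have k := hS (R₁ ∪ U₂ ∪ U') R₁ (TD.join _ _ _ _ j1 h' (by grind) (by grind)) (by grind)
          (by grind)
      have e : U₁ ∪ U₂ ∪ U' = U₁ ∪ (R₁ ∪ U₂ ∪ U') := by grind
      rw [e]; exact k

/-- Connected sets, via crossing edges. -/
def Conn (G : SimpleGraph V) (B : Finset V) : Prop :=
  B.Nonempty ∧ ∀ p : V → Prop, (∃ a ∈ B, p a) → (∃ b ∈ B, ¬ p b) →
    ∃ a ∈ B, p a ∧ ∃ b ∈ B, ¬ p b ∧ G.Adj a b

lemma Conn.connSet {B : Finset V} (h : Conn G B) : Paper.ConnSet G (↑B : Set V) := by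
  unfold Paper.ConnSet
  obtain ⟨v, hv⟩ := h.1
  have key : ∀ u (hu : u ∈ B), (G.induce (↑B : Set V)).Reachable ⟨v, hv⟩ ⟨u, hu⟩ := by
    by_contra! hc
    obtain ⟨u, hu, hur⟩ := hc
    obtain ⟨a, ha, ⟨ha', hpa⟩, b, hb, hpb, hab⟩ := h.2
      (fun u => ∃ hu : u ∈ B, (G.induce (↑B : Set V)).Reachable ⟨v, hv⟩ ⟨u, hu⟩)
      ⟨v, hv, hv, Reachable.refl _⟩ ⟨u, hu, fun ⟨_, h⟩ => hur h⟩
    refine hpb ⟨hb, hpa.trans (Adj.reachable ?_)⟩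
    simpa using hab
  have : Nonempty (↑B : Set V) := ⟨⟨v, hv⟩⟩
  refine ⟨?_⟩
  rintro ⟨a, ha⟩ ⟨b, hb⟩
  exact (key a ha).symm.trans (key b hb)

lemma exists_comp [Fintype V] (X : Finset V) (v : V) (hv : v ∉ X) :
    ∃ C : Finset V, v ∈ C ∧ (∀ c ∈ C, c ∉ X) ∧ Conn G C ∧
      ∀ a b, a ∈ C → b ∉ C → G.Adj a b → b ∈ X := by
  let F : Finset (Finset V) := Finset.univ.filter fun C => v ∈ C ∧ (∀ c ∈ C, c ∉ X) ∧ Conn G C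
  have hF : {v} ∈ F := by
    simp only [F, Finset.mem_filter, Finset.mem_univ, true_and]
    refine ⟨by simp, by simpa using hv, ⟨v, by simp⟩, ?_⟩
    intro p ⟨a, ha, h1⟩ ⟨b, hb, h2⟩
    simp at ha hb; subst ha; subst hb; exact absurd h1 h2
  obtain ⟨C, hC, hmax⟩ := Finset.exists_max_image F Finset.card ⟨_, hF⟩
  simp only [F, Finset.mem_filter, Finset.mem_univ, true_and] at hC hmax
  refine ⟨C, hC.1, hC.2.1, hC.2.2, fun a b ha hb hab => ?_⟩
  by_contra hbX
  have := hmax (insert b C) ⟨by grind, by grind, ⟨v, by grind⟩, ?_⟩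
  · rw [Finset.card_insert_of_notMem hb] at this; omega
  · intro p h1 h2
    have hc := hC.2.2.2 p
    have hs := hab.symm
    by_cases h3 : ∃ a ∈ C, p a
    · by_cases h4 : ∃ a ∈ C, ¬ p a
      · obtain ⟨x, hx, px, y, hy, py, hxy⟩ := hc h3 h4
        exact ⟨x, by grind, px, y, by grind, py, hxy⟩
      · push Not at h4
        refine ⟨a, by grind, h4 a ha, b, by grind, ?_, hab⟩
        obtain ⟨z, hz, hpz⟩ := h2
        grind
    · push Not at h3
      refine ⟨b, by grind, ?_, a, by grind, h3 a ha, hs⟩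
      obtain ⟨z, hz, hpz⟩ := h1
      grind

/-- Two sets touch. -/
def Touch (G : SimpleGraph V) (A B : Finset V) : Prop :=
  ∃ a ∈ A, ∃ b ∈ B, a = b ∨ G.Adj a b

lemma Touch.symm {A B : Finset V} (h : Touch G A B) : Touch G B A := by
  obtain ⟨a, ha, b, hb, h⟩ := h
  exact ⟨b, hb, a, ha, h.imp Eq.symm (fun h => h.symm)⟩

def Bramble (G : SimpleGraph V) (BB : Finset (Finset V)) : Prop :=
  (∀ B ∈ BB, Conn G B) ∧ ∀ A ∈ BB, ∀ B ∈ BB, Touch G A B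

def Covers (X : Finset V) (BB : Finset (Finset V)) : Prop := ∀ B ∈ BB, ∃ v ∈ B, v ∈ X

/-- the admissibility of a bag -/
def Adm (k : ℕ) (BB : Finset (Finset V)) (W : Finset V) : Prop := k < W.card → ¬ Covers W BB

lemma transform [Fintype V] {k : ℕ} {BB : Finset (Finset V)} {X C S : Finset V}
    (hB : ∀ B ∈ BB, Conn G B)
    (hXC : ∀ c ∈ C, c ∉ X) (hC : ∀ a b, a ∈ C → b ∉ C → G.Adj a b → b ∈ X)
    (hX : Covers X BB) (hXk : X.card ≤ k)
    (hmin : ∀ Y, Covers Y BB → X.card ≤ Y.card)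
    (hS : Covers S BB) (hSC : ∀ c ∈ C, c ∉ S)
    {U R : Finset V} (h : TD G (Adm k (insert C BB)) U R) :
    (∀ a b, a ∉ U → b ∈ U → b ∉ R → ¬ G.Adj a b) → (∀ s ∈ S, s ∈ U → s ∈ R) →
    ∀ Z : Finset V, U ⊆ Z → (∀ a b, a ∉ Z → b ∈ Z → b ∉ R → ¬ G.Adj a b) →
      (∀ s ∈ S, s ∈ Z → s ∈ R) →
      TD G (Adm k BB) ((U ∩ C) ∪ (X ∩ Z)) ((R ∩ C) ∪ (X ∩ Z)) := by
  induction h with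
  | leaf R h =>
    intro _ _ Z hRZ hZ hSZ
    refine TD.leaf _ ?_
    intro hk hcov
    have c1 : Covers ((X \ Z) ∪ (R \ C)) BB := by
      intro B hBB
      by_contra! hc
      obtain ⟨x, hxB, hx⟩ := hX B hBB
      obtain ⟨s, hsB, hs⟩ := hS B hBB
      obtain ⟨a, ha, pa, b, hb, pb, hab⟩ := (hB B hBB).2 (fun v => v ∉ Z ∧ v ∉ C)
        ⟨s, hsB, by grind⟩ ⟨x, hxB, by grind⟩
      have e1 := hC b a
      have e2 := hZ a b
      have := hab.symm
      grind
    have c2 := hmin _ c1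
    have c3 : ((X \ Z) ∪ (R \ C)).card ≤ (X \ Z).card + (R \ C).card := Finset.card_union_le _ _
    have c4 : ((R ∩ C) ∪ (X ∩ Z)).card ≤ (R ∩ C).card + (X ∩ Z).card := Finset.card_union_le _ _
    have c5 := Finset.card_sdiff_add_card_inter X Z
    have c6 := Finset.card_sdiff_add_card_inter R C
    refine h (by omega) ?_
    intro B hBB
    rcases Finset.mem_insert.1 hBB with rfl | hBB
    · by_contra! hc
      have : (R ∩ B) ∪ (X ∩ Z) ⊆ X := by grind
      have := Finset.card_le_card this
      omega
    · by_contra! hc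
      obtain ⟨x, hxB, hx⟩ := hcov B hBB
      obtain ⟨s, hsB, hs⟩ := hS B hBB
      obtain ⟨a, ha, pa, b, hb, pb, hab⟩ := (hB B hBB).2 (fun v => v ∉ Z)
        ⟨s, hsB, by grind⟩ ⟨x, hxB, by grind⟩
      have e2 := hZ a b
      grind
  | join U₁ R₁ U₂ R₂ h₁ h₂ hi he ih₁ ih₂ =>
    intro hU hSU Z hUZ hZ hSZ
    have s₁ := h₁.sub
    have s₂ := h₂.sub
    have H1 : ∀ a b, a ∉ U₁ → b ∈ U₁ → b ∉ R₁ → ¬ G.Adj a b := by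
      intro a b h1 h2 h3 hab
      have := he b a
      have := hU a b
      have := hab.symm
      grind
    have H2 : ∀ a b, a ∉ U₂ → b ∈ U₂ → b ∉ R₂ → ¬ G.Adj a b := by
      intro a b h1 h2 h3 hab
      have := he a b
      have := hU a b
      grind
    have K1 := ih₁ H1 (by grind) Z (by grind) hZ hSZ
    have K2 := ih₂ H2 (by grind) U₂ (by grind) H2 (by grind)
    refine TD.join' K1 K2 (by grind) ?_ (by grind)
    intro a b ha ha' hb hb' hab
    have := he a b
    have := hU a b
    grind

lemma exists_adm [Fintype V] (k : ℕ) (hk : ∀ BB, Bramble G BB → ∃ X, X.card ≤ k ∧ Covers X BB) :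
    ∀ n (BB : Finset (Finset V)), Fintype.card (Finset V) - BB.card ≤ n → Bramble G BB →
      ∃ R, TD G (Adm k BB) Finset.univ R := by
  intro n
  induction n with
  | zero =>
    intro BB hn hBB
    have : BB.card ≤ Fintype.card (Finset V) := Finset.card_le_univ _
    have : BB = Finset.univ := Finset.card_eq_iff_eq_univ _ |>.1 (by omega)
    have := (hBB.1 ∅ (by rw [this]; simp)).1
    simp at this
  | succ n ih =>
    intro BB hn hBB
    obtain ⟨X0, hX0k, hX0⟩ := hk BB hBB
    obtain ⟨X, hXF, hXm⟩ := Finset.exists_min_image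
      (Finset.univ.filter fun X : Finset V => Covers X BB) Finset.card ⟨X0, by simpa using hX0⟩
    simp only [Finset.mem_filter, Finset.mem_univ, true_and] at hXF hXm
    have hXk : X.card ≤ k := (hXm X0 hX0).trans hX0k
    by_contra hno
    -- every component gives a piece
    have piece : ∀ C : Finset V, (∀ c ∈ C, c ∉ X) → Conn G C →
        (∀ a b, a ∈ C → b ∉ C → G.Adj a b → b ∈ X) → TD G (Adm k BB) (C ∪ X) X := by
      intro C hCX hCc hC
      by_cases hbr : ∀ B ∈ BB, Touch G C B
      · have hCB : C ∉ BB := by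
          intro hCB
          obtain ⟨v, hv, hv'⟩ := hXF C hCB
          exact hCX v hv hv'
        have hb' : Bramble G (insert C BB) := by
          refine ⟨?_, ?_⟩
          · intro B hB
            rcases Finset.mem_insert.1 hB with rfl | hB
            · exact hCc
            · exact hBB.1 B hB
          · intro A hA B hB
            rcases Finset.mem_insert.1 hB with hB1 | hB1
            · rcases Finset.mem_insert.1 hA with hA1 | hA1
              · obtain ⟨v, hv⟩ := hCc.1
                rw [hA1, hB1]
                exact ⟨v, hv, v, hv, Or.inl rfl⟩
              · rw [hB1]; exact (hbr A hA1).symm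
            · rcases Finset.mem_insert.1 hA with hA1 | hA1
              · rw [hA1]; exact hbr B hB1
              · exact hBB.2 A hA1 B hB1
        have hcard := Finset.card_insert_of_notMem hCB
        obtain ⟨R, hR⟩ := ih (insert C BB) (by omega) hb'
        rcases TD.reroot (Q := Adm k BB) hR with h | ⟨S, pS, qS, hS⟩
        · exact absurd ⟨R, h⟩ hno
        · have hS' := hS R R (TD.leaf R hR.prop) (by grind) (by grind)
          have e : (Finset.univ ∪ R : Finset V) = Finset.univ := by simp
          rw [e] at hS'
          unfold Adm at qS
          push Not at qS
          obtain ⟨qS1, qS2⟩ := qS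
          have hSC : ∀ c ∈ C, c ∉ S := by
            intro c hc hcS
            refine pS qS1 ?_
            intro B hB
            rcases Finset.mem_insert.1 hB with rfl | hB
            · exact ⟨c, hc, hcS⟩
            · exact qS2 B hB
          have K := transform hBB.1 hCX hC hXF hXk hXm qS2 hSC hS' (by simp) (by simp)
            Finset.univ (by simp) (by simp) (by simp)
          have e1 : (Finset.univ ∩ C) ∪ (X ∩ Finset.univ) = C ∪ X := by simp
          have e2 : (S ∩ C) ∪ (X ∩ Finset.univ) = X := by grind
          rwa [e1, e2] at K
      · push Not at hbr
        obtain ⟨B, hB, hCB⟩ := hbr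
        have hq : Adm k BB (C ∪ X.filter fun x => ∃ c ∈ C, G.Adj c x) := by
          intro _ hcov
          obtain ⟨v, hv, hv'⟩ := hcov B hB
          apply hCB
          rcases Finset.mem_union.1 hv' with h | h
          · exact ⟨v, h, v, hv, Or.inl rfl⟩
          · obtain ⟨c, hc, hcv⟩ := (Finset.mem_filter.1 h).2
            exact ⟨c, hc, v, hv, Or.inr hcv⟩
        refine TD.join' (TD.leaf X (fun h => absurd h (by omega))) (TD.leaf _ hq) (by grind) ?_
          (by grind)
        intro a b ha ha' hb hb' hab
        have := hab.symm
        grind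
    -- glue
    obtain ⟨U, hUF, hUm⟩ := Finset.exists_max_image
      (Finset.univ.filter fun U : Finset V => TD G (Adm k BB) U X ∧ 
        ∀ a b, a ∈ U → a ∉ X → b ∉ U → ¬ G.Adj a b) Finset.card
        ⟨X, by
          simp only [Finset.mem_filter, Finset.mem_univ, true_and]
          exact ⟨TD.leaf X (fun h => absurd h (by omega)), by grind⟩⟩
    simp only [Finset.mem_filter, Finset.mem_univ, true_and] at hUF hUm
    have hXU := hUF.1.sub
    apply hno
    refine ⟨X, ?_⟩
    suffices U = Finset.univ by rw [← this]; exact hUF.1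
    by_contra hne
    obtain ⟨v, hv⟩ : ∃ v, v ∉ U := by
      by_contra! hc
      exact hne (Finset.eq_univ_iff_forall.2 hc)
    obtain ⟨C, hvC, hCX, hCc, hC⟩ := exists_comp (G := G) X v (fun h => hv (hXU h))
    have hCU : ∀ c ∈ C, c ∉ U := by
      intro c hc hcU
      obtain ⟨a, ha, pa, b, hb, pb, hab⟩ := hCc.2 (fun v => v ∈ U) ⟨c, hc, hcU⟩ ⟨v, hvC, hv⟩
      exact hUF.2 a b pa (hCX a ha) pb hab
    have hnew : TD G (Adm k BB) (U ∪ (C ∪ X)) X := by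
      refine TD.join _ _ _ _ hUF.1 (piece C hCX hCc hC) (by grind) ?_
      intro a b ha ha' hb hb'
      exact hUF.2 a b ha (by grind) hb'
    have := hUm _ ⟨hnew, by
      intro a b ha haX hb hab
      have := hUF.2 a b
      have := hC a b
      grind⟩
    have hss : U ⊂ U ∪ (C ∪ X) := by
      rw [Finset.ssubset_iff_of_subset (by grind)]
      exact ⟨v, by grind, hv⟩
    have := Finset.card_lt_card hss
    omega

lemma bramble_cover [Fintype V] (d : ℕ)
    (h : ∀ w : V → ℝ, (∀ v, 0 ≤ w v ∧ w v ≤ 1) → (∑ v, w v) ≤ 1 →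
      ∃ X : Finset V, X.card ≤ d ∧
        ∀ Dset : Set V, Paper.IsCompAvoiding G (↑X : Set V) Dset →
          (∑ v, Dset.indicator w v) ≤ 1 / 2) (BB : Finset (Finset V)) (hBB : Bramble G BB) :
    ∃ X, X.card ≤ 2 * d ∧ Covers X BB := by
  obtain ⟨H, hHF, hHm⟩ := Finset.exists_min_image
      (Finset.univ.filter fun X : Finset V => Covers X BB) Finset.card ⟨Finset.univ, by
        simp only [Finset.mem_filter, Finset.mem_univ, true_and]
        intro B hB
        obtain ⟨v, hv⟩ := (hBB.1 B hB).1
        exact ⟨v, hv, by simp⟩⟩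
  simp only [Finset.mem_filter, Finset.mem_univ, true_and] at hHF hHm
  refine ⟨H, ?_, hHF⟩
  by_contra! hlt
  have hpos : (0 : ℝ) < H.card := by exact_mod_cast (by omega : 0 < H.card)
  obtain ⟨X, hXd, hX⟩ := h (fun v => if v ∈ H then (1 : ℝ) / H.card else 0) (by
    intro v
    have h1 : (1 : ℝ) ≤ H.card := by exact_mod_cast (by omega : 1 ≤ H.card)
    split_ifs
    · exact ⟨by positivity, by rw [div_le_one hpos]; exact h1⟩
    · exact ⟨le_rfl, zero_le_one⟩) (by
    rw [← Finset.sum_filter]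
    simp
    rw [mul_inv_cancel₀ hpos.ne'])
  have hXn : ¬ Covers X BB := fun hc => by
    have := hHm X hc
    omega
  unfold Covers at hXn
  push Not at hXn
  obtain ⟨B₀, hB₀, hB₀X⟩ := hXn
  obtain ⟨v, hv⟩ := (hBB.1 B₀ hB₀).1
  obtain ⟨C, hvC, hCX, hCc, hC⟩ := exists_comp (G := G) X v (hB₀X v hv)
  have hsub : ∀ B ∈ BB, (∀ v ∈ B, v ∉ X) → (∃ v ∈ B, v ∈ C) → ∀ v ∈ B, v ∈ C := by
    intro B hB hBX hBC u hu
    by_contra huC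
    obtain ⟨a, ha, pa, b, hb, pb, hab⟩ := (hBB.1 B hB).2 (fun v => v ∈ C) hBC ⟨u, hu, huC⟩
    exact hBX b hb (hC a b pa pb hab)
  have hB₀C := hsub B₀ hB₀ hB₀X ⟨v, hv, hvC⟩
  have hcov : Covers ((H ∩ C) ∪ X) BB := by
    intro B hB
    by_contra! hc
    have hBX : ∀ v ∈ B, v ∉ X := by grind
    obtain ⟨a, ha, b, hb, hab⟩ := hBB.2 B₀ hB₀ B hB
    have hbC : b ∈ C := by
      rcases hab with rfl | hab
      · exact hB₀C _ ha
      · by_contra hbC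
        exact hBX b hb (hC a b (hB₀C a ha) hbC hab)
    have := hsub B hB hBX ⟨b, hb, hbC⟩
    obtain ⟨u, hu, huH⟩ := hHF B hB
    grind
  have h1 := hHm _ hcov
  have h2 : ((H ∩ C) ∪ X).card ≤ (H ∩ C).card + X.card := Finset.card_union_le _ _
  have h3 := hX (↑C : Set V) ⟨fun c hc => by simpa using hCX c hc, hCc.connSet, by
    rintro u hu huX ⟨c, hc, huc⟩
    exact huX (hC c u hc hu huc.symm)⟩
  have h4 : (∑ v, (↑C : Set V).indicator (fun v => if v ∈ H then (1 : ℝ) / H.card else 0) v)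
      = (H ∩ C).card * (1 / H.card) := by
    have : ∀ v, (↑C : Set V).indicator (fun v => if v ∈ H then (1 : ℝ) / H.card else 0) v
      = if v ∈ H ∩ C then (1 : ℝ) / H.card else 0 := by
      intro v
      by_cases h1 : v ∈ C <;> by_cases h2 : v ∈ H <;> simp [h1, h2]
    rw [Finset.sum_congr rfl (fun v _ => this v), Finset.sum_ite_mem, Finset.univ_inter,
      Finset.sum_const, nsmul_eq_mul]
  rw [h4, mul_one_div, div_le_iff₀ hpos] at h3
  have h5 : (2 * (H ∩ C).card : ℝ) ≤ H.card := by linarith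
  have h6 : 2 * (H ∩ C).card ≤ H.card := by exact_mod_cast h5
  omega

lemma tree_join {ι₁ ι₂ : Type} [Finite ι₁] [Finite ι₂] {T₁ : SimpleGraph ι₁} {T₂ : SimpleGraph ι₂}
    (h₁ : T₁.IsTree) (h₂ : T₂.IsTree) (r₁ : ι₁) (r₂ : ι₂) :
    ((T₁ ⊕g T₂) ⊔ edge (Sum.inl r₁) (Sum.inr r₂)).IsTree := by
  rw [isTree_iff_connected_and_card] at *
  refine ⟨h₁.1.sum_sup_edge h₂.1, ?_⟩
  rw [edgeSet_sup, edgeSet_edge_of_ne (by simp), Set.union_singleton, Nat.card_coe_set_eq,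
    Set.ncard_insert_of_notMem (by simp) (Set.toFinite _), ← Nat.card_coe_set_eq,
    Nat.card_congr edgeSetSumEquiv, Nat.card_sum, Nat.card_sum]
  omega

lemma conn_image {α β : Type} {A : SimpleGraph α} {B : SimpleGraph β} (f : α → β)
    (hf : ∀ a b, A.Adj a b → B.Adj (f a) (f b)) {s : Set α} (hs : (A.induce s).Connected) :
    (B.induce (f '' s)).Connected := by
  let g : A.induce s →g B.induce (f '' s) :=
    ⟨fun x => ⟨f x, ⟨x, x.2, rfl⟩⟩, fun {a b} h => by
      have : A.Adj a b := h
      exact hf _ _ this⟩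
  have hg : Function.Surjective g := by
    rintro ⟨_, x, hx, rfl⟩
    exact ⟨⟨x, hx⟩, rfl⟩
  have := hs.nonempty
  have : Nonempty (f '' s) := Nonempty.map g inferInstance
  refine ⟨?_⟩
  exact hs.preconnected.map g hg

lemma TD.realize {U R : Finset V} (h : TD G P U R) :
    ∃ (ι : Type) (_ : Finite ι) (T : SimpleGraph ι) (χ : ι → Finset V) (r : ι),
      T.IsTree ∧ χ r = R ∧ (∀ i, P (χ i)) ∧ (∀ i, χ i ⊆ U) ∧
      (∀ v ∈ U, ∃ i, v ∈ χ i) ∧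
      (∀ u ∈ U, ∀ v ∈ U, G.Adj u v → ∃ i, u ∈ χ i ∧ v ∈ χ i) ∧
      (∀ v ∈ U, (T.induce {i | v ∈ χ i}).Connected) := by
  induction h with
  | leaf R h =>
    refine ⟨Unit, inferInstance, ⊥, fun _ => R, (), IsTree.of_subsingleton, rfl, fun _ => h,
      fun _ => Finset.Subset.refl _, fun v hv => ⟨(), hv⟩, fun u hu v hv _ => ⟨(), hu, hv⟩, ?_⟩
    intro v hv
    have : Nonempty {i : Unit | v ∈ R} := ⟨⟨(), hv⟩⟩
    refine ⟨?_⟩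
    intro a b
    rw [Subsingleton.elim a b]
  | join U₁ R₁ U₂ R₂ h₁ h₂ hi he ih₁ ih₂ =>
    obtain ⟨ι₁, f₁, T₁, χ₁, r₁, t₁, hr₁, p₁, s₁, v₁, e₁, c₁⟩ := ih₁
    obtain ⟨ι₂, f₂, T₂, χ₂, r₂, t₂, hr₂, p₂, s₂, v₂, e₂, c₂⟩ := ih₂
    refine ⟨ι₁ ⊕ ι₂, inferInstance, (T₁ ⊕g T₂) ⊔ edge (Sum.inl r₁) (Sum.inr r₂),
      Sum.elim χ₁ χ₂, Sum.inl r₁, tree_join t₁ t₂ r₁ r₂, hr₁, ?_, ?_, ?_, ?_, ?_⟩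
    · rintro (i | i)
      · exact p₁ i
      · exact p₂ i
    · rintro (i | i)
      · exact (s₁ i).trans Finset.subset_union_left
      · exact (s₂ i).trans Finset.subset_union_right
    · intro v hv
      rcases Finset.mem_union.1 hv with h | h
      · obtain ⟨i, hi⟩ := v₁ v h
        exact ⟨Sum.inl i, hi⟩
      · obtain ⟨i, hi⟩ := v₂ v h
        exact ⟨Sum.inr i, hi⟩
    · intro u hu v hv huv
      have a1 := he u v
      have a2 := he v u
      have a3 := huv.symm
      have : (u ∈ U₁ ∧ v ∈ U₁) ∨ (u ∈ U₂ ∧ v ∈ U₂) := by grind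
      rcases this with ⟨h, h'⟩ | ⟨h, h'⟩
      · obtain ⟨i, hi⟩ := e₁ u h v h' huv
        exact ⟨Sum.inl i, hi⟩
      · obtain ⟨i, hi⟩ := e₂ u h v h' huv
        exact ⟨Sum.inr i, hi⟩
    · intro v hv
      have hset : {i | v ∈ Sum.elim χ₁ χ₂ i}
          = Sum.inl '' {i | v ∈ χ₁ i} ∪ Sum.inr '' {i | v ∈ χ₂ i} := by
        ext (i | i) <;> simp
      rw [hset]
      have l1 : v ∈ U₁ → (((T₁ ⊕g T₂) ⊔ edge (Sum.inl r₁) (Sum.inr r₂)).induce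
          (Sum.inl '' {i | v ∈ χ₁ i})).Connected := fun h =>
        conn_image Sum.inl (fun a b hab => Or.inl (by simpa using hab)) (c₁ v h)
      have l2 : v ∈ U₂ → (((T₁ ⊕g T₂) ⊔ edge (Sum.inl r₁) (Sum.inr r₂)).induce
          (Sum.inr '' {i | v ∈ χ₂ i})).Connected := fun h =>
        conn_image Sum.inr (fun a b hab => Or.inl (by simpa using hab)) (c₂ v h)
      by_cases m₁ : v ∈ U₁
      · by_cases m₂ : v ∈ U₂
        · obtain ⟨q₁, q₂⟩ := hi v m₁ m₂
          refine connected_induce_union (v := Sum.inl r₁) (w := Sum.inr r₂) 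
            (l1 m₁).preconnected (l2 m₂).preconnected ?_ ?_ ?_
          · exact ⟨r₁, by simpa [hr₁] using q₁, rfl⟩
          · exact ⟨r₂, by simpa [hr₂] using q₂, rfl⟩
          · simp [edge_adj]
        · have : {i | v ∈ χ₂ i} = ∅ := by
            ext i; simp; exact fun h => m₂ (s₂ i h)
          rw [this, Set.image_empty, Set.union_empty]
          exact l1 m₁
      · have : {i | v ∈ χ₁ i} = ∅ := by
          ext i; simp; exact fun h => m₁ (s₁ i h)
        rw [this, Set.image_empty, Set.empty_union]
        exact l2 (by grind)

end

end TWB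

/-- If every weight function on `G` admits a balanced separator of size at most `d`,
then `G` has treewidth at most `2d`. -/
theorem treewidth_of_balanced_separators {V : Type} [Fintype V] (G : SimpleGraph V)
    (d : ℕ)
    (h : ∀ w : V → ℝ, (∀ v, 0 ≤ w v ∧ w v ≤ 1) → (∑ v, w v) ≤ 1 →
      ∃ X : Finset V, X.card ≤ d ∧
        ∀ Dset : Set V, Paper.IsCompAvoiding G (↑X : Set V) Dset →
          (∑ v, Dset.indicator w v) ≤ 1 / 2) :
    Paper.HasTreeDecompWidth G (2 * d) := by
  classical
  obtain ⟨R, hR⟩ := TWB.exists_adm (G := G) (2 * d) (TWB.bramble_cover d h) _ ∅ le_rfl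
    ⟨by simp, by simp⟩
  obtain ⟨ι, _, T, χ, r, t, _, p, _, v, e, c⟩ := hR.realize
  refine ⟨ι, T, χ, t, fun u => v u (by simp), fun a b hab => e a (by simp) b (by simp) hab,
    fun u => c u (by simp), fun i => ?_⟩
  by_contra! hc
  exact p i (by omega) (by intro B hB; simp at hB)
end
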